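/- arXiv:2409.05039 — 8 statements merged into one kernel-verified Lean document; each statement's English description precedes it below -/
import Mathlib

section
/- Every split digraph G with no sources admits a 2-kernel K with 2|K| ≤ |V(G)|. -/
/-- There is a directed path (walk) of length at most `k` from `x` to `y`
in the digraph with adjacency relation `E`. -/
def ReachesIn {V : Type*} (E : V → V → Prop) : ℕ → V → V → Prop
  | 0, x, y => x = y
  | k + 1, x, y => x = y ∨ ∃ z, E x z ∧ ReachesIn E k z y

/-- `X` k-covers `Y`: every vertex of `Y` is joined from some vertex of `X`
by a directed path of length at most `k`. -/
def KCovers {V : Type*} (E : V → V → Prop) (k : ℕ) (X Y : Set V) : Prop :=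
  ∀ y ∈ Y, ∃ x ∈ X, ReachesIn E k x y

/-- `X` is a stable set: no edge has both ends in `X`. -/
def StableSet {V : Type*} (E : V → V → Prop) (X : Set V) : Prop :=
  ∀ x ∈ X, ∀ y ∈ X, ¬ E x y

/-- A `k`-kernel: a stable set that k-covers the whole vertex set. -/
def IsKernel {V : Type*} (E : V → V → Prop) (k : ℕ) (X : Set V) : Prop :=
  StableSet E X ∧ KCovers E k X Set.univ

/-- A source: a vertex of in-degree zero. -/
def IsSource {V : Type*} (E : V → V → Prop) (v : V) : Prop := ∀ u, ¬ E u v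

/-- An oriented graph: no loops and no directed cycles of length two. -/
def Oriented {V : Type*} (E : V → V → Prop) : Prop :=
  (∀ v, ¬ E v v) ∧ ∀ u v, E u v → ¬ E v u

/-- The induced subdigraph on a set `S` of vertices. -/
def Induce {V : Type*} (E : V → V → Prop) (S : Set V) : V → V → Prop :=
  fun a b => a ∈ S ∧ b ∈ S ∧ E a b

/-- `E` induces a tournament on `T`: any two distinct vertices of `T` are
joined by exactly one directed edge. -/
def IsTournamentOn {V : Type*} (E : V → V → Prop) (T : Set V) : Prop :=
  ∀ u ∈ T, ∀ v ∈ T, u ≠ v → (E u v ∨ E v u) ∧ ¬ (E u v ∧ E v u)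

/-- The relation `E` is acyclic: there is no directed cycle. -/
def AcyclicRel {V : Type*} (E : V → V → Prop) : Prop :=
  ∀ x y, E x y → ¬ Relation.ReflTransGen E y x

/-- A split of an oriented graph: a partition `(S,T)` of the vertex set
where `S` is stable and `T` induces a tournament. -/
def IsSplit {V : Type*} (E : V → V → Prop) (S T : Set V) : Prop :=
  S ∪ T = Set.univ ∧ Disjoint S T ∧ StableSet E S ∧ IsTournamentOn E T

/-- A break of an oriented graph: a partition `(S,T)` of the vertex set
where `S` induces an acyclic digraph and `T` induces a tournament. -/
def IsBreak {V : Type*} (E : V → V → Prop) (S T : Set V) : Prop :=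
  S ∪ T = Set.univ ∧ Disjoint S T ∧ AcyclicRel (Induce E S) ∧ IsTournamentOn E T

/-- `N⁺_G[X]`: the set of vertices that belong to `X` or have an in-neighbour in `X`. -/
def ClosedOut {V : Type*} (E : V → V → Prop) (X : Set V) : Set V :=
  {v | v ∈ X ∨ ∃ x ∈ X, E x v}

theorem reachesIn_two_iff {V : Type*} {E : V → V → Prop} {x y : V} :
    ReachesIn E 2 x y ↔ x = y ∨ E x y ∨ ∃ z, E x z ∧ E z y := by
  simp only [ReachesIn]
  constructor
  · rintro (h | ⟨z, hz, rfl | ⟨u, hu, rfl⟩⟩)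
    · exact Or.inl h
    · exact Or.inr (Or.inl hz)
    · exact Or.inr (Or.inr ⟨z, hz, hu⟩)
  · rintro (h | h | ⟨z, hz, hu⟩)
    · exact Or.inl h
    · exact Or.inr ⟨y, h, Or.inl rfl⟩
    · exact Or.inr ⟨z, hz, Or.inr ⟨y, hu, rfl⟩⟩

/-- Every in-neighbour of `t` in `S` is reached from `t` by a path of length two. -/
def Returning {V : Type*} (E : V → V → Prop) (S : Finset V) (t : V) : Prop :=
  ∀ b ∈ S, E b t → ∃ q, E t q ∧ E q b

/-- A split digraph without sources, in which every vertex `s ∈ S` has a chosen in-neighbour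
`parent s`, and every vertex `x ∈ T` that is not returning has a chosen in-neighbour
`guard x ∈ S` all of whose in-neighbours are in-neighbours of `x`. -/
structure GuardedSplit {V : Type*} (E : V → V → Prop) where
  S : Finset V
  T : Finset V
  mem : ∀ v, v ∈ S ∨ v ∈ T
  disj : ∀ v ∈ S, v ∉ T
  irrefl : ∀ v, ¬ E v v
  stable : ∀ x ∈ S, ∀ y ∈ S, ¬ E x y
  total : ∀ u ∈ T, ∀ v ∈ T, u ≠ v → E u v ∨ E v u
  exists_in : ∀ v, ∃ u, E u v
  parent : V → V
  parent_mem : ∀ s ∈ S, parent s ∈ T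
  parent_edge : ∀ s ∈ S, E (parent s) s
  guard : V → V
  guard_mem : ∀ x ∈ T, ¬ Returning E S x → guard x ∈ S
  guard_edge : ∀ x ∈ T, ¬ Returning E S x → E (guard x) x
  guard_dom : ∀ x ∈ T, ¬ Returning E S x → ∀ q, E q (guard x) → E q x

namespace GuardedSplit

open Classical

variable {V : Type*} {E : V → V → Prop}

theorem mem_T_of_edge (G : GuardedSplit E) {q b : V} (hb : b ∈ G.S) (h : E q b) : q ∈ G.T :=
  (G.mem q).resolve_left fun hq => G.stable q hq b hb h

/-- The number of vertices whose parent is `x`. -/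
noncomputable def weight (G : GuardedSplit E) (x : V) : ℕ :=
  (G.S.filter fun s => G.parent s = x).card

/-- `t` is equal or adjacent to `x`. -/
def Dom (E : V → V → Prop) (t x : V) : Prop := x = t ∨ E t x

/-- The vertex `x` is not returning and its guard can be put in a stable set with `t`. -/
def Guarded (G : GuardedSplit E) (t x : V) : Prop :=
  ¬ Returning E G.S x ∧ ¬ E t (G.guard x) ∧ ¬ E (G.guard x) t

/-- The price paid for `x` by the kernel built from `t`. -/
noncomputable def price (G : GuardedSplit E) (t x : V) : ℕ :=
  if Dom E t x then 0 else if G.Guarded t x then min 1 (G.weight x) else G.weight x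

/-- An upper bound for the size of the kernel built from `t`. -/
noncomputable def cost (G : GuardedSplit E) (t : V) : ℕ := 1 + ∑ x ∈ G.T, G.price t x

theorem card_filter_parent_le (G : GuardedSplit E) (A B : Finset V)
    (hA : ∀ s ∈ A, s ∈ G.S ∧ G.parent s ∈ B) : A.card ≤ ∑ x ∈ B, G.weight x := by
  rw [Finset.card_eq_sum_card_fiberwise (f := G.parent) (t := B) (fun s hs => (hA s hs).2)]
  refine Finset.sum_le_sum fun x _ => Finset.card_le_card fun s hs => ?_
  rw [Finset.mem_filter] at hs ⊢
  exact ⟨(hA s hs.1).1, hs.2⟩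

theorem sum_weight (G : GuardedSplit E) : ∑ x ∈ G.T, G.weight x = G.S.card :=
  (Finset.card_eq_sum_card_fiberwise (f := G.parent) (t := G.T) G.parent_mem).symm

theorem weight_parent_pos (G : GuardedSplit E) {s : V} (hs : s ∈ G.S) :
    0 < G.weight (G.parent s) :=
  Finset.card_pos.2 ⟨s, Finset.mem_filter.2 ⟨hs, rfl⟩⟩

/-- The vertices of `T` whose guards are put in the kernel built from `t`. -/
noncomputable def guardedSet (G : GuardedSplit E) (t : V) : Finset V :=
  G.T.filter fun x => ¬ Dom E t x ∧ G.Guarded t x ∧ 0 < G.weight x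

/-- The vertex `t` together with the guards of `guardedSet t`. -/
noncomputable def base (G : GuardedSplit E) (t : V) : Finset V :=
  insert t ((G.guardedSet t).image G.guard)

/-- The kernel built from `t`: add to `base t` all vertices of `S` that it does not 2-cover. -/
noncomputable def kernel (G : GuardedSplit E) (t : V) : Finset V :=
  G.base t ∪ G.S.filter fun s => ¬ ∃ x ∈ G.base t, ReachesIn E 2 x s

theorem card_kernel_le (G : GuardedSplit E) (t : V) : (G.kernel t).card ≤ G.cost t := by
  have h1 : (G.base t).card ≤ 1 + (G.guardedSet t).card := by
    rw [add_comm]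
    exact (Finset.card_insert_le _ _).trans (Nat.add_le_add_right Finset.card_image_le 1)
  have h2 : (G.S.filter fun s => ¬ ∃ x ∈ G.base t, ReachesIn E 2 x s).card ≤
      ∑ x ∈ G.T.filter (fun x => ¬ Dom E t x ∧ ¬ G.Guarded t x), G.weight x := by
    refine G.card_filter_parent_le _ _ fun s hs => ?_
    rw [Finset.mem_filter] at hs
    obtain ⟨hs, hn⟩ := hs
    refine ⟨hs, Finset.mem_filter.2 ⟨G.parent_mem s hs, fun hd => hn ?_, fun hg => hn ?_⟩⟩
    · refine ⟨t, Finset.mem_insert_self _ _, reachesIn_two_iff.2 (Or.inr ?_)⟩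
      rcases hd with hd | hd
      · exact Or.inl (hd ▸ G.parent_edge s hs)
      · exact Or.inr ⟨_, hd, G.parent_edge s hs⟩
    · by_cases hd : Dom E t (G.parent s)
      · refine ⟨t, Finset.mem_insert_self _ _, reachesIn_two_iff.2 (Or.inr ?_)⟩
        rcases hd with hd | hd
        · exact Or.inl (hd ▸ G.parent_edge s hs)
        · exact Or.inr ⟨_, hd, G.parent_edge s hs⟩
      · refine ⟨G.guard (G.parent s), Finset.mem_insert_of_mem (Finset.mem_image_of_mem _
          (Finset.mem_filter.2 ⟨G.parent_mem s hs, hd, hg, G.weight_parent_pos hs⟩)),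
          reachesIn_two_iff.2 (Or.inr (Or.inr ⟨_, G.guard_edge _ (G.parent_mem s hs) hg.1,
            G.parent_edge s hs⟩))⟩
  have h3 : (G.guardedSet t).card +
      ∑ x ∈ G.T.filter (fun x => ¬ Dom E t x ∧ ¬ G.Guarded t x), G.weight x ≤
      ∑ x ∈ G.T, G.price t x := by
    rw [guardedSet, Finset.card_filter, Finset.sum_filter, ← Finset.sum_add_distrib]
    refine Finset.sum_le_sum fun x _ => ?_
    unfold price
    by_cases hd : Dom E t x <;> by_cases hg : G.Guarded t x <;> simp [hd, hg]
    split_ifs <;> omega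
  have h4 := Finset.card_union_le (G.base t)
    (G.S.filter fun s => ¬ ∃ x ∈ G.base t, ReachesIn E 2 x s)
  unfold kernel cost
  omega

theorem mem_kernel_cases (G : GuardedSplit E) {t x : V} (hx : x ∈ G.kernel t) :
    x = t ∨ (x ∈ G.S ∧ ((¬ E t x ∧ ¬ E x t) ∨ ¬ ReachesIn E 2 t x)) := by
  rcases Finset.mem_union.1 hx with hx | hx
  · rcases Finset.mem_insert.1 hx with hx | hx
    · exact Or.inl hx
    · obtain ⟨u, hu, rfl⟩ := Finset.mem_image.1 hx
      obtain ⟨huT, _, hg, _⟩ := Finset.mem_filter.1 hu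
      exact Or.inr ⟨G.guard_mem u huT hg.1, Or.inl hg.2⟩
  · obtain ⟨hS, hn⟩ := Finset.mem_filter.1 hx
    exact Or.inr ⟨hS, Or.inr fun h => hn ⟨t, Finset.mem_insert_self _ _, h⟩⟩

theorem not_adj_of_mem_kernel (G : GuardedSplit E) {t x : V} (ht : Returning E G.S t)
    (hx : x ∈ G.kernel t) : ¬ E t x ∧ ¬ E x t := by
  rcases G.mem_kernel_cases hx with rfl | ⟨hS, h | h⟩
  · exact ⟨G.irrefl _, G.irrefl _⟩
  · exact h
  · rw [reachesIn_two_iff] at h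
    push Not at h
    refine ⟨h.2.1, fun hxt => ?_⟩
    obtain ⟨q, h1, h2⟩ := ht x hS hxt
    exact h.2.2 q h1 h2

theorem stable_kernel (G : GuardedSplit E) {t : V} (ht : Returning E G.S t) :
    StableSet E (G.kernel t : Set V) := by
  intro x hx y hy
  rw [Finset.mem_coe] at hx hy
  rcases G.mem_kernel_cases hx with rfl | ⟨hxS, _⟩
  · exact (G.not_adj_of_mem_kernel ht hy).1
  · rcases G.mem_kernel_cases hy with rfl | ⟨hyS, _⟩
    · exact (G.not_adj_of_mem_kernel ht hx).2
    · exact G.stable x hxS y hyS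

theorem base_subset_kernel (G : GuardedSplit E) (t : V) : G.base t ⊆ G.kernel t :=
  Finset.subset_union_left

theorem mem_kernel_or_reached (G : GuardedSplit E) (t : V) {s : V} (hs : s ∈ G.S) :
    s ∈ G.kernel t ∨ ∃ x ∈ G.base t, ReachesIn E 2 x s := by
  by_cases h : ∃ x ∈ G.base t, ReachesIn E 2 x s
  · exact Or.inr h
  · exact Or.inl (Finset.mem_union_right _ (Finset.mem_filter.2 ⟨hs, h⟩))

theorem dominates_of_not_reached (G : GuardedSplit E) {t y : V} (ht : t ∈ G.T) (hy : y ∈ G.T)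
    (h : ¬ ReachesIn E 2 t y) : E y t ∧ ∀ z ∈ G.T, E t z → E y z := by
  rw [reachesIn_two_iff] at h
  push Not at h
  obtain ⟨h1, h2, h3⟩ := h
  refine ⟨(G.total t ht y hy h1).resolve_left h2, fun z hz htz => ?_⟩
  refine (G.total y hy z hz ?_).resolve_right (h3 z htz)
  rintro rfl
  exact h2 htz

theorem returning_of_not_covered (G : GuardedSplit E) {t y : V} (ht : t ∈ G.T) (hy : y ∈ G.T)
    (h : ∀ x ∈ G.kernel t, ¬ ReachesIn E 2 x y) : Returning E G.S y := by
  by_contra hr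
  have htK : t ∈ G.kernel t := G.base_subset_kernel t (Finset.mem_insert_self _ _)
  obtain ⟨hyt, hdom⟩ := G.dominates_of_not_reached ht hy (h t htK)
  have hb := G.guard_edge y hy hr
  rcases G.mem_kernel_or_reached t (G.guard_mem y hy hr) with hk | ⟨x, hx, hxb⟩
  · exact h _ hk (reachesIn_two_iff.2 (Or.inr (Or.inl hb)))
  · have hxK := G.base_subset_kernel t hx
    refine h x hxK (reachesIn_two_iff.2 ?_)
    rcases reachesIn_two_iff.1 hxb with rfl | hxb | ⟨z, hxz, hzb⟩
    · exact Or.inr (Or.inl hb)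
    · exact Or.inr (Or.inr ⟨_, hxb, hb⟩)
    · exact Or.inr (Or.inr ⟨z, hxz, G.guard_dom y hy hr z hzb⟩)

theorem price_le_of_not_covered (G : GuardedSplit E) {t y : V} (ht : t ∈ G.T) (hy : y ∈ G.T)
    (h : ∀ x ∈ G.kernel t, ¬ ReachesIn E 2 x y) {x : V} (hx : x ∈ G.T) :
    G.price y x ≤ G.price t x := by
  have htK : t ∈ G.kernel t := G.base_subset_kernel t (Finset.mem_insert_self _ _)
  obtain ⟨hyt, hdom⟩ := G.dominates_of_not_reached ht hy (h t htK)
  have hD : Dom E t x → Dom E y x := by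
    rintro (rfl | hd)
    · exact Or.inr hyt
    · exact Or.inr (hdom x hx hd)
  unfold price
  by_cases hyx : Dom E y x
  · simp [hyx]
  have htx : ¬ Dom E t x := fun h' => hyx (hD h')
  simp only [hyx, htx, if_false]
  by_cases hw : G.weight x = 0
  · simp [hw]
  by_cases hg : G.Guarded t x
  · have hgy : G.Guarded y x := by
      refine ⟨hg.1, fun h' => hyx (Or.inr (G.guard_dom x hx hg.1 y h')), fun h' => ?_⟩
      refine h (G.guard x) (G.base_subset_kernel t (Finset.mem_insert_of_mem
        (Finset.mem_image_of_mem _ (Finset.mem_filter.2 ⟨hx, htx, hg, by omega⟩)))) ?_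
      exact reachesIn_two_iff.2 (Or.inr (Or.inl h'))
    simp [hg, hgy]
  · simp only [hg, if_false]
    split_ifs <;> omega

theorem card_univ [Fintype V] (G : GuardedSplit E) :
    Fintype.card V = G.T.card + G.S.card := by
  rw [← Finset.card_union_of_disjoint
    (Finset.disjoint_left.2 fun v hT hS => G.disj v hS hT), ← Finset.card_univ]
  congr 1
  ext v
  simpa [or_comm] using G.mem v

theorem exists_kernel_of_cost_le (G : GuardedSplit E) {N : ℕ} {t : V} (ht : t ∈ G.T)
    (hr : Returning E G.S t) (hc : 2 * G.cost t ≤ N) :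
    ∃ K : Finset V, IsKernel E 2 (↑K : Set V) ∧ 2 * K.card ≤ N := by
  obtain ⟨t, ht', hmax⟩ := Finset.exists_max_image
    (G.T.filter fun t => Returning E G.S t ∧ 2 * G.cost t ≤ N)
    (fun t => (G.T.filter fun x => E t x).card) ⟨t, Finset.mem_filter.2 ⟨ht, hr, hc⟩⟩
  obtain ⟨ht, hr, hc⟩ := Finset.mem_filter.1 ht'
  refine ⟨G.kernel t, ⟨G.stable_kernel hr, fun y _ => ?_⟩,
    (Nat.mul_le_mul_left 2 (G.card_kernel_le t)).trans hc⟩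
  rcases G.mem y with hy | hy
  · rcases G.mem_kernel_or_reached t hy with h | ⟨x, hx, h⟩
    · exact ⟨y, h, reachesIn_two_iff.2 (Or.inl rfl)⟩
    · exact ⟨x, G.base_subset_kernel t hx, h⟩
  · by_contra hn
    have h : ∀ x ∈ G.kernel t, ¬ ReachesIn E 2 x y := fun x hx hxy => hn ⟨x, hx, hxy⟩
    have htK : t ∈ G.kernel t := G.base_subset_kernel t (Finset.mem_insert_self _ _)
    obtain ⟨hyt, hdom⟩ := G.dominates_of_not_reached ht hy (h t htK)
    have hcost : G.cost y ≤ G.cost t := Nat.add_le_add_left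
      (Finset.sum_le_sum fun x hx => G.price_le_of_not_covered ht hy h hx) 1
    have hle := hmax y (Finset.mem_filter.2
      ⟨hy, G.returning_of_not_covered ht hy h, by omega⟩)
    refine absurd hle (not_le.2 (Finset.card_lt_card ?_))
    refine Finset.ssubset_iff_of_subset (fun x hx => ?_) |>.2
      ⟨t, Finset.mem_filter.2 ⟨ht, hyt⟩, fun h' => G.irrefl t (Finset.mem_filter.1 h').2⟩
    obtain ⟨hx, htx⟩ := Finset.mem_filter.1 hx
    exact Finset.mem_filter.2 ⟨hx, hdom x hx htx⟩

/-- The vertices of `T` with no in-neighbour in `S`. -/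
noncomputable def free (G : GuardedSplit E) : Finset V := G.T.filter fun t => ∀ b ∈ G.S, ¬ E b t

/-- The vertices of `T` with an in-neighbour in `S`. -/
noncomputable def hit (G : GuardedSplit E) : Finset V := G.T.filter fun t => ¬ ∀ b ∈ G.S, ¬ E b t

theorem sum_free_add_sum_hit {M : Type*} [AddCommMonoid M] (G : GuardedSplit E) (F : V → M) :
    ∑ x ∈ G.free, F x + ∑ x ∈ G.hit, F x = ∑ x ∈ G.T, F x :=
  Finset.sum_filter_add_sum_filter_not _ _ _

theorem card_free_add_card_hit (G : GuardedSplit E) :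
    G.free.card + G.hit.card = G.T.card :=
  Finset.card_filter_add_card_filter_not _

theorem exists_stable_side_kernel (G : GuardedSplit E)
    (hfree : ∀ t ∈ G.free, ∃ u ∈ G.hit, E u t) :
    ∃ K ⊆ G.S, IsKernel E 2 (↑K : Set V) ∧
      K.card ≤ G.hit.card + ∑ x ∈ G.free, G.weight x := by
  have hex : ∀ t ∈ G.hit, ∃ b ∈ G.S, E b t := fun t ht => by
    have := (Finset.mem_filter.1 ht).2
    push Not at this
    exact this
  choose! h hS hE using hex
  have hsub : G.hit.image h ∪ G.S.filter (fun s => G.parent s ∈ G.free) ⊆ G.S := by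
    refine Finset.union_subset (fun x hx => ?_) (Finset.filter_subset _ _)
    obtain ⟨t, ht, rfl⟩ := Finset.mem_image.1 hx
    exact hS t ht
  have hcover : ∀ t ∈ G.hit, h t ∈ G.hit.image h ∪ G.S.filter (fun s => G.parent s ∈ G.free) :=
    fun t ht => Finset.mem_union_left _ (Finset.mem_image_of_mem _ ht)
  have hsplit : ∀ t ∈ G.T, t ∈ G.free ∨ t ∈ G.hit := fun t ht => by
    by_cases h' : ∀ b ∈ G.S, ¬ E b t
    · exact Or.inl (Finset.mem_filter.2 ⟨ht, h'⟩)
    · exact Or.inr (Finset.mem_filter.2 ⟨ht, h'⟩)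
  refine ⟨_, hsub, ⟨fun x hx y hy => G.stable x (hsub hx) y (hsub hy), fun y _ => ?_⟩, ?_⟩
  · rcases G.mem y with hy | hy
    · rcases hsplit _ (G.parent_mem y hy) with hp | hp
      · exact ⟨y, Finset.mem_union_right _ (Finset.mem_filter.2 ⟨hy, hp⟩),
          reachesIn_two_iff.2 (Or.inl rfl)⟩
      · exact ⟨_, hcover _ hp,
          reachesIn_two_iff.2 (Or.inr (Or.inr ⟨_, hE _ hp, G.parent_edge y hy⟩))⟩
    · rcases hsplit y hy with hp | hp
      · obtain ⟨u, hu, huy⟩ := hfree y hp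
        exact ⟨_, hcover _ hu, reachesIn_two_iff.2 (Or.inr (Or.inr ⟨_, hE _ hu, huy⟩))⟩
      · exact ⟨_, hcover _ hp, reachesIn_two_iff.2 (Or.inr (Or.inl (hE _ hp)))⟩
  · refine (Finset.card_union_le _ _).trans (Nat.add_le_add Finset.card_image_le ?_)
    exact G.card_filter_parent_le _ _ fun s hs => Finset.mem_filter.1 hs

theorem returning_of_mem_free (G : GuardedSplit E) {t : V} (ht : t ∈ G.free) :
    Returning E G.S t :=
  fun b hb hbt => absurd hbt ((Finset.mem_filter.1 ht).2 b hb)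

theorem dom_or_guarded_of_mem_free (G : GuardedSplit E) {t x : V} (ht : t ∈ G.free)
    (hx : x ∈ G.T) (hr : ¬ Returning E G.S x) : Dom E t x ∨ G.Guarded t x := by
  by_cases h : E t (G.guard x)
  · exact Or.inl (Or.inr (G.guard_dom x hx hr t h))
  · exact Or.inr ⟨hr, h, (Finset.mem_filter.1 ht).2 _ (G.guard_mem x hx hr)⟩

/-- The positive part of `weight x - 1`. -/
noncomputable def excess (G : GuardedSplit E) (x : V) : ℤ := ((G.weight x - 1 : ℕ) : ℤ)

/-- `1` if `x` is no parent, and `0` otherwise. -/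
noncomputable def idle (G : GuardedSplit E) (x : V) : ℤ := ((1 - G.weight x : ℕ) : ℤ)

/-- `1` or `-1` as `x` is cheap or expensive for the kernel built from `t`. -/
noncomputable def sign (G : GuardedSplit E) (t x : V) : ℤ :=
  if Dom E t x ∨ G.Guarded t x then 1 else -1

theorem excess_nonneg (G : GuardedSplit E) (x : V) : 0 ≤ G.excess x := Int.natCast_nonneg _

theorem idle_nonneg (G : GuardedSplit E) (x : V) : 0 ≤ G.idle x := Int.natCast_nonneg _

theorem weight_eq (G : GuardedSplit E) (x : V) :
    (G.weight x : ℤ) = 1 + G.excess x - G.idle x := by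
  unfold excess idle
  omega

theorem idle_add_excess_mul_sign_le (G : GuardedSplit E) (t x : V) :
    G.idle x + G.excess x * G.sign t x + (if Dom E t x then 2 * (1 - G.idle x) else 0) ≤
      1 + G.weight x - 2 * G.price t x := by
  unfold sign price excess idle
  by_cases hd : Dom E t x <;> by_cases hg : G.Guarded t x <;> simp [hd, hg] <;> omega

theorem idle_le_one (G : GuardedSplit E) (x : V) : G.idle x ≤ 1 := by
  unfold idle
  omega

theorem slack_le (G : GuardedSplit E) {t : V} (ht : t ∈ G.T) :
    ∑ x ∈ G.T, G.idle x + ∑ x ∈ G.T, G.excess x * G.sign t x - 2 * G.idle t ≤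
      (G.T.card + G.S.card : ℤ) - 2 * G.cost t := by
  have h1 := Finset.sum_le_sum fun x (_ : x ∈ G.T) => G.idle_add_excess_mul_sign_le t x
  have h2 : 2 * (1 - G.idle t) ≤
      ∑ x ∈ G.T, (if Dom E t x then 2 * (1 - G.idle x) else 0) := by
    have h := Finset.single_le_sum
      (f := fun x => if Dom E t x then 2 * (1 - G.idle x) else 0) (fun x _ => ?_) ht
    · simpa [Dom] using h
    · have := G.idle_le_one x
      show (0:ℤ) ≤ if Dom E t x then _ else _
      split_ifs <;> omega
  simp only [Finset.sum_add_distrib, Finset.sum_sub_distrib, ← Finset.mul_sum] at h1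
  have h3 : (∑ x ∈ G.T, (G.weight x : ℤ)) = G.S.card := by exact_mod_cast G.sum_weight
  have h4 : ∑ x ∈ G.T, (1 : ℤ) = G.T.card := by simp
  have h5 : (G.cost t : ℤ) = 1 + ∑ x ∈ G.T, (G.price t x : ℤ) := by
    unfold cost
    push_cast
    rfl
  linarith

noncomputable def returningSet (G : GuardedSplit E) : Finset V :=
  G.T.filter fun t => Returning E G.S t

noncomputable def nonreturningSet (G : GuardedSplit E) : Finset V :=
  G.T.filter fun t => ¬ Returning E G.S t

theorem sum_returning_add_sum_nonreturning (G : GuardedSplit E) (F : V → ℤ) :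
    ∑ x ∈ G.returningSet, F x + ∑ x ∈ G.nonreturningSet, F x = ∑ x ∈ G.T, F x :=
  Finset.sum_filter_add_sum_filter_not _ _ _

theorem free_subset_returningSet (G : GuardedSplit E) : G.free ⊆ G.returningSet := fun _ ht =>
  Finset.mem_filter.2 ⟨(Finset.mem_filter.1 ht).1, G.returning_of_mem_free ht⟩

theorem sum_returning_square_nonneg (G : GuardedSplit E) :
    0 ≤ ∑ t ∈ G.returningSet, ∑ x ∈ G.returningSet,
      G.excess t * (G.excess x * G.sign t x) := by
  have hcomm : ∑ t ∈ G.returningSet, ∑ x ∈ G.returningSet,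
      G.excess t * (G.excess x * G.sign t x) = ∑ t ∈ G.returningSet, ∑ x ∈ G.returningSet,
      G.excess x * (G.excess t * G.sign x t) := Finset.sum_comm
  have h : 0 ≤ ∑ t ∈ G.returningSet, ∑ x ∈ G.returningSet,
      (G.excess t * (G.excess x * G.sign t x) + G.excess x * (G.excess t * G.sign x t)) := by
    refine Finset.sum_nonneg fun t ht => Finset.sum_nonneg fun x hx => ?_
    have hsum : 0 ≤ G.sign t x + G.sign x t := by
      have hd : Dom E t x ∨ Dom E x t := by
        by_cases hxt : x = t
        · exact Or.inl (Or.inl hxt)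
        · exact (G.total t (Finset.mem_filter.1 ht).1 x (Finset.mem_filter.1 hx).1
            (Ne.symm hxt)).imp Or.inr Or.inr
      unfold sign
      rcases hd with hd | hd <;> simp only [hd, true_or, if_true] <;> split_ifs <;> norm_num
    have := mul_nonneg (mul_nonneg (G.excess_nonneg t) (G.excess_nonneg x)) hsum
    linarith
  simp only [Finset.sum_add_distrib] at h
  linarith

theorem sum_sign_nonreturning_of_mem_free (G : GuardedSplit E) {t : V} (ht : t ∈ G.free) :
    ∑ x ∈ G.nonreturningSet, G.excess x * G.sign t x = ∑ x ∈ G.nonreturningSet, G.excess x := by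
  refine Finset.sum_congr rfl fun x hx => ?_
  obtain ⟨hx, hr⟩ := Finset.mem_filter.1 hx
  rw [sign, if_pos (G.dom_or_guarded_of_mem_free ht hx hr), mul_one]

theorem neg_sum_le_sum_sign (G : GuardedSplit E) (t : V) (A : Finset V) :
    - ∑ x ∈ A, G.excess x ≤ ∑ x ∈ A, G.excess x * G.sign t x := by
  rw [← Finset.sum_neg_distrib]
  refine Finset.sum_le_sum fun x _ => ?_
  have := G.excess_nonneg x
  unfold sign
  split_ifs <;> linarith

theorem exists_returning_cost_le (G : GuardedSplit E) (hne : G.free.Nonempty)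
    (h : G.hit = ∅ ∨
      G.T.card + G.S.card < 2 * (G.hit.card + ∑ x ∈ G.free, G.weight x)) :
    ∃ t ∈ G.returningSet, 2 * G.cost t ≤ G.T.card + G.S.card := by
  set τ := ∑ x ∈ G.free, G.excess x with hτ
  set γ := ∑ x ∈ G.returningSet \ G.free, G.excess x with hγ
  set ω := ∑ x ∈ G.nonreturningSet, G.excess x with hω
  set z₀ := ∑ x ∈ G.free, G.idle x with hz₀
  set z₁ := ∑ x ∈ G.hit, G.idle x with hz₁
  have hτ0 : 0 ≤ τ := Finset.sum_nonneg fun x _ => G.excess_nonneg x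
  have hγ0 : 0 ≤ γ := Finset.sum_nonneg fun x _ => G.excess_nonneg x
  have hω0 : 0 ≤ ω := Finset.sum_nonneg fun x _ => G.excess_nonneg x
  have hz₀0 : 0 ≤ z₀ := Finset.sum_nonneg fun x _ => G.idle_nonneg x
  have hz₁0 : 0 ≤ z₁ := Finset.sum_nonneg fun x _ => G.idle_nonneg x
  have hret : ∑ x ∈ G.returningSet, G.excess x = τ + γ := by
    rw [add_comm]
    exact (Finset.sum_sdiff G.free_subset_returningSet).symm
  have hidle : ∑ x ∈ G.T, G.idle x = z₀ + z₁ := (G.sum_free_add_sum_hit _).symm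
  have hhit : ∑ x ∈ G.hit, G.excess x = γ + ω := by
    have h1 := G.sum_free_add_sum_hit G.excess
    have h2 := G.sum_returning_add_sum_nonreturning G.excess
    linarith
  have hgap : (G.hit = ∅ ∧ γ = 0 ∧ ω = 0) ∨ z₀ + γ + ω < z₁ + τ := by
    rcases h with h | h
    · left
      rw [h, Finset.sum_empty] at hhit
      exact ⟨h, by linarith, by linarith⟩
    · right
      have hw : ∀ A : Finset V, ((∑ x ∈ A, G.weight x : ℕ) : ℤ) =
          A.card + ∑ x ∈ A, G.excess x - ∑ x ∈ A, G.idle x := fun A => by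
        push_cast
        simp [G.weight_eq, Finset.sum_add_distrib, Finset.sum_sub_distrib]
      have h1 := hw G.free
      have h2 := hw G.hit
      have h3 := G.sum_free_add_sum_hit G.weight
      have h4 := G.card_free_add_card_hit
      have h5 := G.sum_weight
      rw [hhit] at h2
      omega
  suffices hs : ∃ t ∈ G.returningSet,
      0 ≤ ∑ x ∈ G.T, G.idle x + ∑ x ∈ G.T, G.excess x * G.sign t x - 2 * G.idle t by
    obtain ⟨t, ht, h0⟩ := hs
    have := G.slack_le (Finset.mem_filter.1 ht).1
    exact ⟨t, ht, by omega⟩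
  by_cases hpos : 0 < τ + γ
  · by_contra! hneg
    have hlt : ∑ t ∈ G.returningSet, G.excess t *
        (∑ x ∈ G.T, G.idle x + ∑ x ∈ G.T, G.excess x * G.sign t x) < 0 := by
      rw [← hret] at hpos
      obtain ⟨t, ht, htpos⟩ := Finset.exists_lt_of_sum_lt (s := G.returningSet)
        (f := fun _ => (0 : ℤ)) (g := G.excess) (by simpa using hpos)
      have key : ∀ t, 0 < G.excess t → G.idle t = 0 := fun t h => by
        unfold excess at h
        unfold idle
        omega
      refine Finset.sum_neg' (fun t ht => ?_) ⟨t, ht, ?_⟩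
      · rcases (G.excess_nonneg t).eq_or_lt with h0 | h0
        · simp [← h0]
        · have := hneg t ht
          rw [key t h0] at this
          exact mul_nonpos_of_nonneg_of_nonpos h0.le (by linarith)
      · have := hneg t ht
        rw [key t htpos] at this
        exact mul_neg_of_pos_of_neg htpos (by linarith)
    have hexp : ∑ t ∈ G.returningSet, G.excess t *
        (∑ x ∈ G.T, G.idle x + ∑ x ∈ G.T, G.excess x * G.sign t x) =
        (τ + γ) * (z₀ + z₁) +
        (∑ t ∈ G.returningSet, ∑ x ∈ G.returningSet, G.excess t * (G.excess x * G.sign t x)) +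
        ∑ t ∈ G.returningSet, G.excess t *
          ∑ x ∈ G.nonreturningSet, G.excess x * G.sign t x := by
      simp only [← G.sum_returning_add_sum_nonreturning (fun x => G.excess x * G.sign _ x),
        mul_add, Finset.sum_add_distrib, hidle, ← Finset.sum_mul, hret, Finset.mul_sum]
      ring
    have hcross : ω * τ - ω * γ ≤ ∑ t ∈ G.returningSet, G.excess t *
          ∑ x ∈ G.nonreturningSet, G.excess x * G.sign t x := by
      rw [← Finset.sum_sdiff G.free_subset_returningSet]
      have h1 : ∑ t ∈ G.free, G.excess t *
          ∑ x ∈ G.nonreturningSet, G.excess x * G.sign t x = τ * ω := by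
        rw [hτ, Finset.sum_mul]
        exact Finset.sum_congr rfl fun t ht => by
          rw [G.sum_sign_nonreturning_of_mem_free ht]
      have h2 : γ * -ω ≤ ∑ t ∈ G.returningSet \ G.free, G.excess t *
          ∑ x ∈ G.nonreturningSet, G.excess x * G.sign t x := by
        rw [hγ, Finset.sum_mul]
        exact Finset.sum_le_sum fun t _ =>
          mul_le_mul_of_nonneg_left (G.neg_sum_le_sum_sign t _) (G.excess_nonneg t)
      linarith
    have hsq := G.sum_returning_square_nonneg
    have hfin : 0 ≤ (τ + γ) * (z₀ + z₁) + (ω * τ - ω * γ) := by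
      rcases hgap with ⟨_, h1, h2⟩ | hgap
      · rw [h1, h2]
        nlinarith
      · rcases le_total γ τ with hle | hle
        · nlinarith [mul_nonneg hω0 (sub_nonneg.2 hle),
            mul_nonneg (add_nonneg hτ0 hγ0) (add_nonneg hz₀0 hz₁0)]
        · have h1 : 0 ≤ (γ - τ) * (z₁ - ω) := mul_nonneg (by linarith) (by linarith)
          nlinarith [mul_nonneg (add_nonneg hτ0 hγ0) hz₀0, mul_nonneg hτ0 hz₁0]
    linarith
  · have hzero : τ = 0 ∧ γ = 0 := ⟨by linarith, by linarith⟩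
    have hfree : ∀ t ∈ G.free, 0 ≤ ∑ x ∈ G.T, G.excess x * G.sign t x := fun t ht => by
      rw [← G.sum_returning_add_sum_nonreturning, G.sum_sign_nonreturning_of_mem_free ht]
      have := G.neg_sum_le_sum_sign t G.returningSet
      linarith
    by_cases hp : ∃ t ∈ G.free, G.idle t = 0
    · obtain ⟨t, ht, hid⟩ := hp
      refine ⟨t, G.free_subset_returningSet ht, ?_⟩
      have := hfree t ht
      linarith
    · push Not at hp
      obtain ⟨t, ht⟩ := hne
      refine ⟨t, G.free_subset_returningSet ht, ?_⟩
      have h1 : ∀ x ∈ G.free, G.idle x = 1 := fun x hx => by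
        have h1 := hp x hx
        have h2 := G.idle_nonneg x
        have h3 := G.idle_le_one x
        omega
      have hz : z₀ = G.free.card := by
        rw [hz₀, Finset.sum_congr rfl h1]
        simp
      have hcard : 0 < G.free.card := Finset.card_pos.2 ⟨t, ht⟩
      have h2 := hfree t ht
      have h3 := h1 t ht
      rcases hgap with ⟨hempty, _, _⟩ | hgap
      · have htwo : 1 < G.free.card := by
          obtain ⟨u, hu⟩ := G.exists_in t
          obtain ⟨htT, htS⟩ := Finset.mem_filter.1 ht
          have huT : u ∈ G.T := (G.mem u).resolve_left fun huS => htS u huS hu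
          have hufree : u ∈ G.free := by
            by_contra hn
            have : u ∈ G.hit := Finset.mem_filter.2
              ⟨huT, fun h' => hn (Finset.mem_filter.2 ⟨huT, h'⟩)⟩
            simp [hempty] at this
          refine Finset.one_lt_card.2 ⟨u, hufree, t, ht, ?_⟩
          rintro rfl
          exact G.irrefl _ hu
        omega
      · omega

theorem cost_le_of_dominates_hit (G : GuardedSplit E) {t : V} (hdom : ∀ x ∈ G.hit, E t x) :
    G.cost t ≤ 1 + ∑ x ∈ G.free, G.weight x := by
  unfold cost
  rw [← G.sum_free_add_sum_hit]
  have h1 : ∑ x ∈ G.hit, G.price t x = 0 := Finset.sum_eq_zero fun x hx => by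
    rw [price, if_pos (show Dom E t x from Or.inr (hdom x hx))]
  have h2 : ∑ x ∈ G.free, G.price t x ≤ ∑ x ∈ G.free, G.weight x :=
    Finset.sum_le_sum fun x _ => by
      unfold price
      split_ifs <;> omega
  omega

theorem exists_small_kernel (G : GuardedSplit E) :
    ∃ K : Finset V, IsKernel E 2 (↑K : Set V) ∧ 2 * K.card ≤ G.T.card + G.S.card := by
  have hcard := G.card_free_add_card_hit
  rcases G.free.eq_empty_or_nonempty with hempty | hne
  · obtain ⟨K, hKS, hK, hle⟩ := G.exists_stable_side_kernel (by simp [hempty])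
    have h1 := Finset.card_le_card hKS
    rw [hempty] at hle hcard
    simp only [Finset.sum_empty, Finset.card_empty] at hle hcard
    exact ⟨K, hK, by omega⟩
  by_cases h : G.hit = ∅ ∨
      G.T.card + G.S.card < 2 * (G.hit.card + ∑ x ∈ G.free, G.weight x)
  · obtain ⟨t, ht, hc⟩ := G.exists_returning_cost_le hne h
    obtain ⟨hT, hr⟩ := Finset.mem_filter.1 ht
    exact G.exists_kernel_of_cost_le hT hr hc
  push Not at h
  obtain ⟨hhit, hsmall⟩ := h
  have hpos := Finset.card_pos.2 hhit
  by_cases hfree : ∀ t ∈ G.free, ∃ u ∈ G.hit, E u t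
  · obtain ⟨K, _, hK, hle⟩ := G.exists_stable_side_kernel hfree
    exact ⟨K, hK, by omega⟩
  push Not at hfree
  obtain ⟨t, ht, hn⟩ := hfree
  obtain ⟨htT, htS⟩ := Finset.mem_filter.1 ht
  have hdom : ∀ x ∈ G.hit, E t x := fun x hx => by
    obtain ⟨hxT, hxS⟩ := Finset.mem_filter.1 hx
    refine (G.total t htT x hxT ?_).resolve_right (hn x hx)
    rintro rfl
    exact hxS htS
  have := G.cost_le_of_dominates_hit hdom
  exact G.exists_kernel_of_cost_le htT (G.returning_of_mem_free ht) (by omega)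

end GuardedSplit

open Classical in
theorem exists_guard {V : Type*} {E : V → V → Prop} (S T : Finset V)
    (mem : ∀ v, v ∈ S ∨ v ∈ T) (asymm : ∀ u v, E u v → ¬ E v u)
    (stable : ∀ x ∈ S, ∀ y ∈ S, ¬ E x y)
    (total : ∀ u ∈ T, ∀ v ∈ T, u ≠ v → E u v ∨ E v u)
    (x : V) (hx : x ∈ T) (hr : ¬ Returning E S x) :
    ∃ b ∈ S, E b x ∧ ∀ q, E q b → E q x := by
  unfold Returning at hr
  push Not at hr
  obtain ⟨b, hb, hbx, h⟩ := hr
  refine ⟨b, hb, hbx, fun q hq => ?_⟩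
  have hqT : q ∈ T := (mem q).resolve_left fun hqS => stable q hqS b hb hq
  refine (total q hqT x hx ?_).resolve_right fun hxq => h q hxq hq
  rintro rfl
  exact asymm _ _ hq hbx

/-- Every split digraph $G$ with no sources admits a 2-kernel $K$ with $2|K| \le |G|$. -/
theorem stmt_0 {V : Type*} [Fintype V] (E : V → V → Prop)
    (hor : Oriented E) (S T : Set V) (hsplit : IsSplit E S T)
    (hnosource : ∀ v : V, ¬ IsSource E v) :
    ∃ K : Finset V, IsKernel E 2 (↑K : Set V) ∧ 2 * K.card ≤ Fintype.card V := by
  classical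
  obtain ⟨hunion, hdisj, hstable, htour⟩ := hsplit
  have mem : ∀ v, v ∈ S.toFinset ∨ v ∈ T.toFinset := fun v => by
    simpa using (Set.ext_iff.1 hunion v).2 (Set.mem_univ v)
  have stable : ∀ x ∈ S.toFinset, ∀ y ∈ S.toFinset, ¬ E x y := fun x hx y hy =>
    hstable x (Set.mem_toFinset.1 hx) y (Set.mem_toFinset.1 hy)
  have total : ∀ u ∈ T.toFinset, ∀ v ∈ T.toFinset, u ≠ v → E u v ∨ E v u :=
    fun u hu v hv huv => (htour u (Set.mem_toFinset.1 hu) v (Set.mem_toFinset.1 hv) huv).1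
  have exists_in : ∀ v, ∃ u, E u v := fun v => by
    have := hnosource v
    unfold IsSource at this
    push Not at this
    exact this
  choose parent hparent using exists_in
  choose! guard guard_mem guard_edge guard_dom using
    exists_guard S.toFinset T.toFinset mem hor.2 stable total
  let G : GuardedSplit E :=
    { S := S.toFinset
      T := T.toFinset
      mem := mem
      disj := fun v hS hT => Set.disjoint_left.1 hdisj (Set.mem_toFinset.1 hS)
        (Set.mem_toFinset.1 hT)
      irrefl := hor.1
      stable := stable
      total := total
      exists_in := fun v => ⟨parent v, hparent v⟩
      parent := parent
      parent_mem := fun s hs => (mem _).resolve_left fun h => stable _ h s hs (hparent s)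
      parent_edge := fun s _ => hparent s
      guard := guard
      guard_mem := guard_mem
      guard_edge := guard_edge
      guard_dom := guard_dom }
  obtain ⟨K, hK, hle⟩ := G.exists_small_kernel
  exact ⟨K, hK, by rwa [G.card_univ]⟩
end

section
/- Let (S,T) be a split of an oriented graph G such that S is nonempty and no vertex in S is a source. Then G has a 2-kernel K with 2|K| ≤ |V(G)|. -/
open Classical in
/-- For a total relation on a nonempty finite set with nonnegative weights, some element is
related to at least half of the total weight. -/
theorem exists_half_weight_of_total {α : Type*} (A : Finset α) (hA : A.Nonempty)
    (r : α → α → Prop) (hr : ∀ a ∈ A, ∀ b ∈ A, r a b ∨ r b a) (w : α → ℤ)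
    (hw : ∀ a ∈ A, 0 ≤ w a) :
    ∃ a ∈ A, ∑ b ∈ A, w b ≤ 2 * ∑ b ∈ A with r a b, w b := by
  by_contra! h
  set W := ∑ b ∈ A, w b with hW
  have hlow : W * W ≤ ∑ a ∈ A, w a * (2 * ∑ b ∈ A with r a b, w b) := by
    have hexp : ∑ a ∈ A, w a * (2 * ∑ b ∈ A with r a b, w b) =
        ∑ a ∈ A, ∑ b ∈ A, (if r a b then w a * w b else 0) +
          ∑ a ∈ A, ∑ b ∈ A, (if r b a then w a * w b else 0) := by
      rw [Finset.sum_comm (f := fun a b => if r b a then w a * w b else 0),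
        ← Finset.sum_add_distrib]
      refine Finset.sum_congr rfl fun a _ => ?_
      rw [← Finset.sum_add_distrib, Finset.sum_filter, Finset.mul_sum, Finset.mul_sum]
      refine Finset.sum_congr rfl fun b _ => ?_
      split_ifs <;> ring
    rw [hexp, hW, Finset.sum_mul_sum, ← Finset.sum_add_distrib]
    refine Finset.sum_le_sum fun a ha => ?_
    rw [← Finset.sum_add_distrib]
    refine Finset.sum_le_sum fun b hb => ?_
    have := mul_nonneg (hw a ha) (hw b hb)
    rcases hr a ha b hb with h | h <;> simp only [h, if_true] <;> split_ifs <;> linarith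
  have hup : ∑ a ∈ A, w a * (2 * ∑ b ∈ A with r a b, w b) ≤ W * (W - 1) := by
    rw [hW, Finset.sum_mul, ← hW]
    exact Finset.sum_le_sum fun a ha =>
      mul_le_mul_of_nonneg_left (by linarith [h a ha]) (hw a ha)
  obtain ⟨a, ha⟩ := hA
  have hpos : 0 ≤ ∑ b ∈ A with r a b, w b :=
    Finset.sum_nonneg fun b hb => hw b (Finset.mem_of_mem_filter b hb)
  nlinarith [h a ha]

open Classical in
/-- A stable set that 2-covers the stable part of a split can be traded for a 2-kernel. -/
theorem exists_kernel_of_kCovers_left {V : Type*} [Fintype V] {E : V → V → Prop}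
    (hor : Oriented E) {S T : Set V} (hsplit : IsSplit E S T) (f : V → V)
    (hf : ∀ s ∈ S, f s ∈ T ∧ E (f s) s) (R K : Finset V) (hK : StableSet E (K : Set V))
    (hKS : KCovers E 2 (K : Set V) S) (hR : ∀ u ∈ R, u ∈ ClosedOut E (K : Set V))
    (m : ℕ) (hKm : K.card ≤ m)
    (hm : (Finset.univ.filter fun s => s ∈ S ∧ f s ∉ R).card + 1 ≤ m) :
    ∃ K' : Finset V, IsKernel E 2 (K' : Set V) ∧ K'.card ≤ m := by
  obtain ⟨hun, -, hSst, hT⟩ := hsplit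
  have hST (v : V) : v ∈ S ∨ v ∈ T := by
    have : v ∈ S ∪ T := hun ▸ Set.mem_univ v
    exact this
  set C : Finset V := Finset.univ.filter fun v =>
    v ∈ T ∧ v ∉ ClosedOut E (K : Set V) ∧ ∀ y ∈ T, y ∈ ClosedOut E (K : Set V) → ¬ E y v with hC
  rcases C.eq_empty_or_nonempty with hCe | hCne
  · refine ⟨K, ⟨hK, fun y _ => ?_⟩, hKm⟩
    rcases hST y with hy | hy
    · exact hKS y hy
    · have hyC : y ∉ C := by simp [hCe]
      by_contra! hcon
      refine hyC (Finset.mem_filter.2 ⟨Finset.mem_univ y, hy, ?_, ?_⟩)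
      · rintro (h | ⟨x, hx, hxy⟩)
        · exact hcon y h (.inl rfl)
        · exact hcon x hx (reachesIn_two_iff.2 (.inr (.inl hxy)))
      · rintro z - (h | ⟨x, hx, hxz⟩) hzy
        · exact hcon z h (reachesIn_two_iff.2 (.inr (.inl hzy)))
        · exact hcon x hx (reachesIn_two_iff.2 (.inr (.inr ⟨z, hxz, hzy⟩)))
  obtain ⟨v, hvC, hvmax⟩ := C.exists_max_image
    (fun v => (Finset.univ.filter fun u => u ∈ T ∧ E v u).card) hCne
  obtain ⟨hvT, hvK, hvK'⟩ := (Finset.mem_filter.1 hvC).2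
  have hvdom (y : V) (hy : y ∈ ClosedOut E (K : Set V)) (hyT : y ∈ T) : E v y :=
    ((hT y hyT v hvT (by rintro rfl; exact hvK hy)).1).resolve_left (hvK' y hyT hy)
  refine ⟨insert v (Finset.univ.filter fun s => s ∈ S ∧ f s ∉ R ∧ ¬ ReachesIn E 2 v s ∧ ¬ E s v),
    ⟨?_, ?_⟩, ?_⟩
  · intro x hx y hy hxy
    simp only [Finset.coe_insert, Finset.coe_filter, Finset.mem_univ, true_and,
      Set.mem_insert_iff, Set.mem_ofPred_eq] at hx hy
    rcases hx with rfl | hx <;> rcases hy with rfl | hy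
    · exact hor.1 _ hxy
    · exact hy.2.2.1 (reachesIn_two_iff.2 (.inr (.inl hxy)))
    · exact hx.2.2.2 hxy
    · exact hSst x hx.1 y hy.1 hxy
  · intro y _
    by_cases hvy : ReachesIn E 2 v y
    · exact ⟨v, by simp, hvy⟩
    rcases hST y with hy | hy
    · refine ⟨y, ?_, .inl rfl⟩
      simp only [Finset.coe_insert, Finset.coe_filter, Finset.mem_univ, true_and,
        Set.mem_insert_iff, Set.mem_ofPred_eq]
      refine .inr ⟨hy, fun hfR => ?_, hvy, fun hyv => ?_⟩
      · exact hvy (reachesIn_two_iff.2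
          (.inr (.inr ⟨f y, hvdom _ (hR _ hfR) (hf y hy).1, (hf y hy).2⟩)))
      · obtain ⟨x, hx, hxy⟩ := hKS y hy
        rcases reachesIn_two_iff.1 hxy with rfl | h | ⟨z, hxz, hzy⟩
        · exact hvK (.inr ⟨x, hx, hyv⟩)
        · have hxT : x ∈ T := (hST x).resolve_left fun hx => hSst x hx y hy h
          exact hvy (reachesIn_two_iff.2 (.inr (.inr ⟨x, hvdom x (.inl hx) hxT, h⟩)))
        · have hzT : z ∈ T := (hST z).resolve_left fun hz => hSst z hz y hy hzy
          exact hvy (reachesIn_two_iff.2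
            (.inr (.inr ⟨z, hvdom z (.inr ⟨x, hx, hxz⟩) hzT, hzy⟩)))
    · exfalso
      rw [reachesIn_two_iff] at hvy
      push Not at hvy
      obtain ⟨hvy0, hvy1, hvy2⟩ := hvy
      have hyv : E y v := ((hT v hvT y hy hvy0).1).resolve_left hvy1
      have hyout (z : V) (hz : z ∈ T) (hvz : E v z) : E y z := by
        have hzy : z ≠ y := by rintro rfl; exact hvy1 hvz
        exact ((hT z hz y hy hzy).1).resolve_left (hvy2 z hvz)
      have hyC : y ∈ C := Finset.mem_filter.2 ⟨Finset.mem_univ y, hy,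
        fun h => hvy1 (hvdom y h hy), fun z hz hzK => hvy2 z (hvdom z hzK hz)⟩
      refine absurd (hvmax y hyC) (not_le.2 (Finset.card_lt_card ?_))
      rw [Finset.ssubset_iff_of_subset]
      · exact ⟨v, by simpa using ⟨hvT, hyv⟩, by simpa using fun _ => hor.1 v⟩
      · intro z hz
        simp only [Finset.mem_filter, Finset.mem_univ, true_and] at hz ⊢
        exact ⟨hz.1, hyout z hz.1 hz.2⟩
  · refine (Finset.card_insert_le _ _).trans (le_trans ?_ hm)
    gcongr
    intro s
    tauto

/-- If $(S,T)$ is a split of an oriented graph $G$ with $S \ne \emptyset$ and no vertex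
of $S$ a source, then $G$ has a 2-kernel $K$ with $2|K| \le |G|$. -/
theorem stmt_1 {V : Type*} [Fintype V] (E : V → V → Prop)
    (hor : Oriented E) (S T : Set V) (hsplit : IsSplit E S T)
    (hS : S.Nonempty) (hnosource : ∀ v ∈ S, ¬ IsSource E v) :
    ∃ K : Finset V, IsKernel E 2 (↑K : Set V) ∧ 2 * K.card ≤ Fintype.card V := by
  classical
  have hsplit' := hsplit
  obtain ⟨hun, hdisj, hSst, hT⟩ := hsplit
  have hST (v : V) : v ∈ S ∨ v ∈ T := by
    have : v ∈ S ∪ T := hun ▸ Set.mem_univ v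
    exact this
  have hpar (v : V) : ∃ u, v ∈ S → u ∈ T ∧ E u v := by
    by_cases hv : v ∈ S
    · obtain ⟨u, hu⟩ := not_forall_not.1 (hnosource v hv)
      exact ⟨u, fun _ => ⟨(hST u).resolve_left fun h => hSst u h v hv hu, hu⟩⟩
    · exact ⟨v, fun h => absurd h hv⟩
  choose f hf using hpar
  set SF : Finset V := Finset.univ.filter (· ∈ S) with hSF
  have memSF (s : V) : s ∈ SF ↔ s ∈ S := by simp [hSF]
  set A : Finset V := SF.image f with hA
  have hAT (u : V) (hu : u ∈ A) : u ∈ T := by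
    obtain ⟨s, hs, rfl⟩ := Finset.mem_image.1 hu
    exact (hf s ((memSF s).1 hs)).1
  have hAne : A.Nonempty := by
    obtain ⟨s, hs⟩ := hS
    exact ⟨f s, Finset.mem_image_of_mem f ((memSF s).2 hs)⟩
  let blocks (s u v : V) : Prop := s ∈ S ∧ E s u ∧ ¬ E s v ∧ ¬ E v s
  let r (u v : V) : Prop := u = v ∨ (E u v ∧ ¬ ∃ s, blocks s u v) ∨ ∃ s, blocks s v u
  let w (u : V) : ℤ := (SF.filter (f · = u)).card - 1
  have htotal (u : V) (hu : u ∈ A) (v : V) (hv : v ∈ A) : r u v ∨ r v u := by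
    have := hT u (hAT u hu) v (hAT v hv)
    simp only [r]
    tauto
  have hw (u : V) (hu : u ∈ A) : 0 ≤ w u := by
    obtain ⟨s, hs, hsu⟩ := Finset.mem_image.1 hu
    have : 0 < (SF.filter (f · = u)).card := Finset.card_pos.2 ⟨s, by simp [hs, hsu]⟩
    simp only [w]
    omega
  obtain ⟨t, htA, htw⟩ := exists_half_weight_of_total A hAne r htotal w hw
  set R : Finset V := A.filter (r t) with hR
  have htT := hAT t htA
  have htR : t ∈ R := by simp [hR, htA, r]
  have hwsum (B : Finset V) : ∑ u ∈ B, w u = ((SF.filter (f · ∈ B)).card : ℤ) - B.card := by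
    have hfib : (SF.filter (f · ∈ B)).card = ∑ u ∈ B, (SF.filter (f · = u)).card := by
      have hmaps : Set.MapsTo f (SF.filter (f · ∈ B) : Finset V) B :=
        fun s hs => (Finset.mem_filter.1 hs).2
      rw [Finset.card_eq_sum_card_fiberwise hmaps]
      refine Finset.sum_congr rfl fun u hu => ?_
      congr 1
      ext s
      simp only [Finset.mem_filter]
      constructor
      · tauto
      · rintro ⟨hs, rfl⟩
        tauto
    simp only [w, Finset.sum_sub_distrib, hfib]
    simp
  set U : Finset V := Finset.univ.filter fun s => s ∈ S ∧ f s ∉ R with hU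
  have hcount : 2 * (R.card + U.card) ≤ Fintype.card V := by
    replace htw : ∑ b ∈ A, w b ≤ 2 * ∑ b ∈ R, w b := by convert htw
    rw [hwsum, hwsum] at htw
    have h1 : SF.filter (f · ∈ A) = SF :=
      Finset.filter_true_of_mem fun s hs => Finset.mem_image_of_mem f hs
    have h2 : (SF.filter (f · ∈ R)).card + U.card = SF.card := by
      rw [← Finset.card_filter_add_card_filter_not (s := SF) (f · ∈ R)]
      congr 2
      ext s
      simp [hU, memSF]
    have h3 : SF.card + A.card ≤ Fintype.card V := by
      rw [← Finset.card_union_of_disjoint]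
      · exact Finset.card_le_univ _
      · exact Finset.disjoint_left.2 fun s hs hsA =>
          Set.disjoint_left.1 hdisj ((memSF s).1 hs) (hAT s hsA)
    rw [h1] at htw
    omega
  have hblock (u : V) : ∃ s, (∃ s', blocks s' u t) → blocks s u t := by
    by_cases h : ∃ s', blocks s' u t
    · obtain ⟨s, hs⟩ := h
      exact ⟨s, fun _ => hs⟩
    · exact ⟨u, fun h' => absurd h' h⟩
  choose g hg using hblock
  set Q : Finset V := (R.filter fun u => ∃ s, blocks s u t).image g with hQ
  have hQmem (s : V) (hs : s ∈ Q) : ∃ u, blocks s u t := by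
    obtain ⟨u, hu, rfl⟩ := Finset.mem_image.1 hs
    exact ⟨u, hg u (Finset.mem_filter.1 hu).2⟩
  have hQcard : Q.card + 1 ≤ R.card := by
    refine Nat.succ_le_of_lt (Finset.card_image_le.trans_lt
      (Finset.card_lt_card (Finset.filter_ssubset.2 ⟨t, htR, ?_⟩)))
    rintro ⟨s, -, h1, h2, -⟩
    exact h2 h1
  have hQcov (u : V) (hu : u ∈ R) (h : ∃ s, blocks s u t) : ∃ s ∈ Q, E s u :=
    ⟨g u, Finset.mem_image_of_mem g (Finset.mem_filter.2 ⟨hu, h⟩), (hg u h).2.1⟩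
  have hRcov (x : V) (hx : x = t ∨ E x t ∧ x ∈ S ∧ ¬ ReachesIn E 2 t x) (u : V) (hu : u ∈ R) :
      u ∈ ClosedOut E ((insert x Q : Finset V) : Set V) := by
    rcases (Finset.mem_filter.1 hu).2 with rfl | ⟨htu, hno⟩ | hs
    · rcases hx with rfl | hx
      · exact .inl (by simp)
      · exact .inr ⟨x, by simp, hx.1⟩
    · rcases hx with rfl | ⟨hxt, hxS, hnr⟩
      · exact .inr ⟨x, by simp, htu⟩
      · refine .inr ⟨x, by simp, ?_⟩
        by_contra hxu
        refine hno ⟨x, hxS, hxt, hxu, fun hux => hnr ?_⟩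
        exact reachesIn_two_iff.2 (.inr (.inr ⟨u, htu, hux⟩))
    · obtain ⟨s, hs, hsu⟩ := hQcov u hu hs
      exact .inr ⟨s, by simp [hs], hsu⟩
  have hfinish (x : V) (hx : x = t ∨ E x t ∧ x ∈ S ∧ ¬ ReachesIn E 2 t x)
      (hgood : x = t → ∀ s ∈ S, E s t → ∃ y ∈ insert x Q, ReachesIn E 2 y s) :
      ∃ K : Finset V, IsKernel E 2 (K : Set V) ∧ K.card ≤ R.card + U.card := by
    set P : Finset V := insert x Q with hP
    set K : Finset V := P ∪ U.filter fun s => ∀ y ∈ P, ¬ ReachesIn E 2 y s with hK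
    have hKx (y : V) (hy : y ∈ K) : y = x ∨ (y ∈ S ∧ (x = t → ¬ E y x ∧ ¬ E x y)) := by
      rcases Finset.mem_union.1 hy with hy | hy
      · rcases Finset.mem_insert.1 hy with rfl | hy
        · exact .inl rfl
        · obtain ⟨u, hS, -, h1, h2⟩ := hQmem y hy
          exact .inr ⟨hS, by rintro rfl; exact ⟨h1, h2⟩⟩
      · obtain ⟨hyU, hyP⟩ := Finset.mem_filter.1 hy
        have hyS : y ∈ S := (Finset.mem_filter.1 hyU).2.1
        refine .inr ⟨hyS, fun hxt => ⟨fun hyx => ?_, fun hxy => ?_⟩⟩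
        · obtain ⟨z, hz, hzy⟩ := hgood hxt y hyS (hxt ▸ hyx)
          exact hyP z hz hzy
        · exact hyP x (Finset.mem_insert_self _ _) (reachesIn_two_iff.2 (.inr (.inl hxy)))
    have hxS : x ≠ t → x ∈ S := fun h => (hx.resolve_left h).2.1
    have hPK (u : V) (hu : u ∈ ClosedOut E (P : Set V)) : u ∈ ClosedOut E (K : Set V) := by
      rcases hu with hu | ⟨y, hy, hyu⟩
      · exact .inl (Finset.mem_union_left _ hu)
      · exact .inr ⟨y, Finset.mem_union_left _ hy, hyu⟩
    refine exists_kernel_of_kCovers_left hor hsplit' f hf R K ?_ ?_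
      (fun u hu => hPK u (hRcov x hx u hu)) _ ?_ ?_
    · intro y hy z hz hyz
      rcases hKx y hy with rfl | ⟨hyS, hyx⟩ <;> rcases hKx z hz with rfl | ⟨hzS, hzx⟩
      · exact hor.1 _ hyz
      · by_cases h : y = t
        · exact (hzx h).2 hyz
        · exact hSst _ (hxS h) _ hzS hyz
      · by_cases h : z = t
        · exact (hyx h).1 hyz
        · exact hSst _ hyS _ (hxS h) hyz
      · exact hSst _ hyS _ hzS hyz
    · intro s hs
      by_cases h : ∃ y ∈ P, ReachesIn E 2 y s
      · obtain ⟨y, hy, hys⟩ := h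
        exact ⟨y, Finset.mem_union_left _ hy, hys⟩
      · push Not at h
        refine ⟨s, Finset.mem_union_right _ (Finset.mem_filter.2 ⟨?_, h⟩), .inl rfl⟩
        refine Finset.mem_filter.2 ⟨Finset.mem_univ s, hs, fun hfR => ?_⟩
        rcases hRcov x hx _ hfR with hfP | ⟨y, hy, hyf⟩
        · exact h _ hfP (reachesIn_two_iff.2 (.inr (.inl (hf s hs).2)))
        · exact h y hy (reachesIn_two_iff.2 (.inr (.inr ⟨_, hyf, (hf s hs).2⟩)))
    · have h1 : K.card ≤ _ := Finset.card_union_le P (U.filter fun s => ∀ y ∈ P, ¬ ReachesIn E 2 y s)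
      have h2 := Finset.card_filter_le U fun s => ∀ y ∈ P, ¬ ReachesIn E 2 y s
      have h3 : P.card ≤ _ := Finset.card_insert_le x Q
      omega
    · have hRpos : 0 < R.card := Finset.card_pos.2 ⟨t, htR⟩
      have hUR : U.card + 1 ≤ R.card + U.card := by omega
      convert hUR
  have : ∃ K : Finset V, IsKernel E 2 (K : Set V) ∧ K.card ≤ R.card + U.card := by
    by_cases hbad : ∃ s ∈ S, E s t ∧ ¬ ReachesIn E 2 t s
    · obtain ⟨s, hs, hst, hns⟩ := hbad
      refine hfinish s (.inr ⟨hst, hs, hns⟩) ?_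
      rintro rfl
      exact absurd hst (hor.1 _)
    · push Not at hbad
      exact hfinish t (.inl rfl) fun _ s hs hst => ⟨t, Finset.mem_insert_self _ _, hbad s hs hst⟩
  obtain ⟨K, hK, hcard⟩ := this
  exact ⟨K, hK, by omega⟩
end

section
/- Let (S,T) be a split of an oriented graph G and let v ∈ T. If v is contained in no strong 2-kernel of G, then there exists a vertex w ≠ v that is an in-neighbour of v such that N⁻_G(w) ⊆ N⁻_G(v), and either w ∈ S and w is a problem for v, or w ∈ T. -/
/-- `s` is a problem for `v`: `s ∈ S` is an in-neighbour of `v`, `v` does not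
2-cover `s`, and no non-neighbour of `v` in `S` 2-covers `s`. -/
def IsProblem {V : Type*} (E : V → V → Prop) (S : Set V) (s v : V) : Prop :=
  s ∈ S ∧ E s v ∧ ¬ ReachesIn E 2 v s ∧
    ∀ u ∈ S, u ≠ v → ¬ E u v → ¬ E v u → ¬ ReachesIn E 2 u s

/-- A strong 2-kernel (relative to the tournament part `T`): a 2-kernel `K` such
that every `u ∈ T` is 1-covered by some vertex of `K` or 2-covered by some vertex
of `K ∩ T`. -/
def IsStrongKernel {V : Type*} (E : V → V → Prop) (T : Set V) (K : Set V) : Prop :=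
  IsKernel E 2 K ∧
    ∀ u ∈ T, (∃ x ∈ K, ReachesIn E 1 x u) ∨ ∃ x ∈ K ∩ T, ReachesIn E 2 x u

/-- If $v ∈ T$ is in no strong 2-kernel, there is an in-neighbour $w ≠ v$ of $v$
with $N^-(w) ⊆ N^-(v)$, and either $w ∈ S$ is a problem for $v$, or $w ∈ T$. -/
theorem stmt_2 {V : Type*} [Fintype V] (E : V → V → Prop)
    (hor : Oriented E) (S T : Set V) (hsplit : IsSplit E S T)
    (v : V) (hv : v ∈ T)
    (hno : ∀ K : Set V, IsStrongKernel E T K → v ∉ K) :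
    ∃ w : V, w ≠ v ∧ E w v ∧ (∀ u, E u w → E u v) ∧
      ((w ∈ S ∧ IsProblem E S w v) ∨ w ∈ T) := by
  obtain ⟨hcover, -, hS, hT⟩ := hsplit
  have hmem : ∀ x, x ∈ S ∨ x ∈ T := fun x => by
    have : x ∈ S ∪ T := hcover ▸ Set.mem_univ x
    exact this
  by_contra hcon
  push Not at hcon
  -- The candidate kernel: `v` together with its non-neighbours in `S`.
  let K : Set V := {x | x = v ∨ (x ∈ S ∧ ¬ E x v ∧ ¬ E v x)}
  have hvK : v ∈ K := Or.inl rfl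
  have hstable : StableSet E K := by
    rintro x (rfl | ⟨hx, hxv, hvx⟩) y (rfl | ⟨hy, hyv, hvy⟩)
    · exact hor.1 _
    · exact hvy
    · exact hxv
    · exact hS x hx y hy
  have hstrong : ∀ u ∈ T, (∃ x ∈ K, ReachesIn E 1 x u) ∨ ∃ x ∈ K ∩ T, ReachesIn E 2 x u := by
    intro u hu
    by_contra h
    push Not at h
    obtain ⟨h1, h2⟩ := h
    have hv2 : ¬ ReachesIn E 2 v u := h2 v ⟨hvK, hv⟩
    have huv : u ≠ v := fun e => hv2 (Or.inl e.symm)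
    have hvu : ¬ E v u := fun e => hv2 (Or.inr ⟨u, e, Or.inl rfl⟩)
    have hEuv : E u v := ((hT u hu v hv huv).1).resolve_right hvu
    refine (hcon u huv hEuv fun a ha => ?_).2 hu
    have hva : ¬ E v a := fun e => hv2 (Or.inr ⟨a, e, Or.inr ⟨u, ha, rfl⟩⟩)
    rcases hmem a with haS | haT
    · by_contra hav
      exact h1 a (Or.inr ⟨haS, hav, hva⟩) (Or.inr ⟨u, ha, rfl⟩)
    · have hne : a ≠ v := fun e => hvu (e ▸ ha)
      exact ((hT a haT v hv hne).1).resolve_right hva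
  refine hno K ⟨⟨hstable, fun y _ => ?_⟩, hstrong⟩ hvK
  rcases hmem y with hyS | hyT
  · by_contra h
    push Not at h
    have hv2 : ¬ ReachesIn E 2 v y := h v hvK
    have hyv : y ≠ v := fun e => hv2 (Or.inl e.symm)
    have hvy : ¬ E v y := fun e => hv2 (Or.inr ⟨y, e, Or.inl rfl⟩)
    have hEyv : E y v := by
      by_contra e
      exact h y (Or.inr ⟨hyS, e, hvy⟩) (Or.inl rfl)
    refine (hcon y hyv hEyv fun a ha => ?_).1 hyS
      ⟨hyS, hEyv, hv2, fun u hu _ huv hvu => h u (Or.inr ⟨hu, huv, hvu⟩)⟩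
    have hva : ¬ E v a := fun e => hv2 (Or.inr ⟨a, e, Or.inr ⟨y, ha, rfl⟩⟩)
    have haT : a ∈ T := (hmem a).resolve_left fun haS => hS a haS y hyS ha
    have hne : a ≠ v := fun e => hvy (e ▸ ha)
    exact ((hT a haT v hv hne).1).resolve_right hva
  · rcases hstrong y hyT with ⟨x, hx, rfl | ⟨z, hxz, hzy⟩⟩ | ⟨x, hx, hxy⟩
    · exact ⟨x, hx, Or.inl rfl⟩
    · exact ⟨x, hx, Or.inr ⟨z, hxz, Or.inl hzy⟩⟩
    · exact ⟨x, hx.1, hxy⟩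
end

section
/- Let (S,T) be a split of an oriented graph G, let v ∈ T, and suppose some vertex s ∈ S is a problem for v. Then v is contained in no 2-kernel of G. -/
/-- If some $s ∈ S$ is a problem for $v ∈ T$, then $v$ is in no 2-kernel. -/
theorem stmt_3 {V : Type*} [Fintype V] (E : V → V → Prop)
    (hor : Oriented E) (S T : Set V) (hsplit : IsSplit E S T)
    (v : V) (hv : v ∈ T) (s : V) (hs : IsProblem E S s v) :
    ∀ K : Set V, IsKernel E 2 K → v ∉ K := by
  rintro K ⟨hstable, hcover⟩ hvK
  obtain ⟨hST, -, -, htour⟩ := hsplit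
  obtain ⟨-, -, hvs, hnon⟩ := hs
  obtain ⟨x, hxK, hxs⟩ := hcover s (Set.mem_univ s)
  by_cases hxv : x = v
  · exact hvs (hxv ▸ hxs)
  have hxST : x ∈ S ∪ T := hST ▸ Set.mem_univ x
  rcases hxST with hxS | hxT
  · exact hnon x hxS hxv (hstable x hxK v hvK) (hstable v hvK x hxK) hxs
  · rcases (htour x hxT v hv hxv).1 with h | h
    · exact hstable x hxK v hvK h
    · exact hstable v hvK x hxK h
end

section
/- Let G be an oriented graph that admits a break, and let f : V(G) → ℕ be any map. Then there is a 2-kernel K of G such that 2·f(N⁺_G[K]) ≥ f(V(G)), where f(X) denotes the sum of f(v) over v ∈ X. -/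
theorem mem_closedOut_of_mem {V : Type*} {E : V → V → Prop} {X : Set V} {v : V} (h : v ∈ X) :
    v ∈ ClosedOut E X := Or.inl h

theorem mem_closedOut_of_adj {V : Type*} {E : V → V → Prop} {X : Set V} {u v : V} (h : u ∈ X)
    (huv : E u v) : v ∈ ClosedOut E X := Or.inr ⟨u, h, huv⟩

theorem AcyclicRel.wellFounded {V : Type*} [Finite V] {r : V → V → Prop} (h : AcyclicRel r) :
    WellFounded r := by
  have irr : Std.Irrefl (Relation.TransGen r) := ⟨fun x hx => by
    obtain ⟨y, hxy, hyx⟩ := Relation.TransGen.head'_iff.1 hx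
    exact h x y hxy hyx⟩
  exact Subrelation.wf (fun hxy => Relation.TransGen.single hxy)
    (Finite.wellFounded_of_trans_of_irrefl (Relation.TransGen r))

/-- Every subset of a set inducing a well-founded relation has a `1`-kernel. -/
theorem exists_stableSet_subset_closedOut {V : Type*} {E : V → V → Prop} {S U : Set V}
    (hwf : WellFounded (Induce E S)) (hU : U ⊆ S) :
    ∃ M ⊆ U, StableSet E M ∧ U ⊆ ClosedOut E M := by
  let m : V → Prop := hwf.fix fun s m => ∀ t, ∀ h : Induce E S t s, t ∈ U → ¬ m t h
  have hm : ∀ s, m s ↔ ∀ t, Induce E S t s → t ∈ U → ¬ m t := fun s =>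
    iff_of_eq (hwf.fix_eq _ s)
  refine ⟨{s | s ∈ U ∧ m s}, fun s hs => hs.1, ?_, ?_⟩
  · intro x hx y hy hxy
    exact (hm y).1 hy.2 x ⟨hU hx.1, hU hy.1, hxy⟩ hx.1 hx.2
  · intro y hy
    by_cases h : m y
    · exact Or.inl ⟨hy, h⟩
    · rw [hm] at h
      push Not at h
      obtain ⟨t, ht, htU, hmt⟩ := h
      exact Or.inr ⟨t, ⟨htU, hmt⟩, ht.2.2⟩

/-- `K` assigns to every vertex `x` a stable set consisting of `x` and vertices of `S` which
dominates every vertex of `S` that is not an in-neighbour of `x`. -/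
structure IsLocalKernel {V : Type*} (E : V → V → Prop) (S : Set V) (K : V → Set V) : Prop where
  stable : ∀ x, StableSet E (K x)
  self_mem : ∀ x, x ∈ K x
  eq_or_mem : ∀ x, ∀ z ∈ K x, z = x ∨ z ∈ S
  mem_closedOut : ∀ x, ∀ s ∈ S, ¬ E s x → s ∈ ClosedOut E (K x)

theorem exists_isLocalKernel {V : Type*} {E : V → V → Prop} {S : Set V}
    (hirr : ∀ v, ¬ E v v) (hwf : WellFounded (Induce E S)) : ∃ K, IsLocalKernel E S K := by
  have key : ∀ x, ∃ M ⊆ {s | s ∈ S ∧ ¬ E s x ∧ ¬ E x s}, StableSet E M ∧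
      {s | s ∈ S ∧ ¬ E s x ∧ ¬ E x s} ⊆ ClosedOut E M := fun x =>
    exists_stableSet_subset_closedOut hwf fun s hs => hs.1
  choose M hMU hMs hMc using key
  refine ⟨fun x => insert x (M x), ?_, fun x => Or.inl rfl, ?_, ?_⟩
  · rintro x a (rfl | ha) b (rfl | hb)
    · exact hirr _
    · exact (hMU _ hb).2.2
    · exact (hMU _ ha).2.1
    · exact hMs x a ha b hb
  · rintro x z (rfl | hz)
    · exact Or.inl rfl
    · exact Or.inr (hMU x hz).1
  · intro x s hs hsx
    by_cases hxs : E x s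
    · exact mem_closedOut_of_adj (Or.inl rfl) hxs
    · rcases hMc x ⟨hs, hsx, hxs⟩ with h | ⟨t, ht, hts⟩
      · exact Or.inl (Or.inr h)
      · exact Or.inr ⟨t, Or.inr ht, hts⟩

/-- `u` is not within distance two of `X`. -/
def IsFar {V : Type*} (E : V → V → Prop) (X : Set V) (u : V) : Prop :=
  ∀ z ∈ ClosedOut E X, z ≠ u ∧ ¬ E z u

theorem exists_reachesIn_two_of_not_isFar {V : Type*} {E : V → V → Prop} {X : Set V} {u : V}
    (h : ¬ IsFar E X u) : ∃ x ∈ X, ReachesIn E 2 x u := by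
  simp only [IsFar, not_forall, not_and_or, not_not, exists_prop] at h
  obtain ⟨z, hz | ⟨x, hx, hxz⟩, rfl | hzu⟩ := h
  · exact ⟨z, hz, Or.inl rfl⟩
  · exact ⟨z, hz, Or.inr ⟨u, hzu, Or.inl rfl⟩⟩
  · exact ⟨x, hx, Or.inr ⟨z, hxz, Or.inl rfl⟩⟩
  · exact ⟨x, hx, Or.inr ⟨z, hxz, Or.inr ⟨u, hzu, rfl⟩⟩⟩

theorem IsFar.anti {V : Type*} {E : V → V → Prop} {X Y : Set V} {u : V} (h : IsFar E Y u)
    (hXY : ClosedOut E X ⊆ ClosedOut E Y) : IsFar E X u :=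
  fun z hz => h z (hXY hz)

/-- `u` is a vertex of `S` far from the local kernel at `x`. -/
def FarStep {V : Type*} (E : V → V → Prop) (S : Set V) (K : V → Set V) (x u : V) : Prop :=
  u ∈ S ∧ IsFar E (K x) u

namespace IsLocalKernel

variable {V : Type*} {E : V → V → Prop} {S T : Set V} {K : V → Set V}

theorem adj_of_farStep (hK : IsLocalKernel E S K) {x u : V} (h : FarStep E S K x u) : E u x := by
  by_contra hux
  exact (h.2 u (hK.mem_closedOut x u h.1 hux)).1 rfl

theorem adj_of_farStep_of_adj (hK : IsLocalKernel E S K) {x u z : V} (h : FarStep E S K x u)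
    (hz : z ∈ S) (hzu : E z u) : E z x := by
  by_contra hzx
  exact (h.2 z (hK.mem_closedOut x z hz hzx)).2 hzu

theorem adj_of_farSteps_of_farStep (hK : IsLocalKernel E S K) {x p q : V}
    (h : Relation.ReflTransGen (FarStep E S K) x p) (hpq : FarStep E S K p q) :
    ∀ z ∈ S, z = q ∨ E z q → E z x := by
  induction h generalizing q with
  | refl =>
    rintro z hz (rfl | hzq)
    · exact hK.adj_of_farStep hpq
    · exact hK.adj_of_farStep_of_adj hpq hz hzq
  | tail _ hop ih =>
    rintro z hz (rfl | hzq)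
    · exact ih hop z hz (Or.inr (hK.adj_of_farStep hpq))
    · exact ih hop z hz (Or.inr (hK.adj_of_farStep_of_adj hpq hz hzq))

theorem eq_or_adj_of_farSteps (hK : IsLocalKernel E S K) {x p : V}
    (h : Relation.ReflTransGen (FarStep E S K) x p) :
    p = x ∨ (p ∈ S ∧ ∀ z ∈ S, z = p ∨ E z p → E z x) := by
  rcases h.cases_tail with h | ⟨o, hxo, hop⟩
  · exact Or.inl h
  · exact Or.inr ⟨hop.1, hK.adj_of_farSteps_of_farStep hxo hop⟩

theorem mem_closedOut_or_mem_closedOut (hK : IsLocalKernel E S K) (hST : S ∪ T = Set.univ)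
    (hT : IsTournamentOn E T) (x y : V) : y ∈ ClosedOut E (K x) ∨ x ∈ ClosedOut E (K y) := by
  by_cases hxy : E x y
  · exact Or.inl (mem_closedOut_of_adj (hK.self_mem x) hxy)
  by_cases hyx : E y x
  · exact Or.inr (mem_closedOut_of_adj (hK.self_mem y) hyx)
  have hx : x ∈ S ∪ T := hST ▸ Set.mem_univ x
  have hy : y ∈ S ∪ T := hST ▸ Set.mem_univ y
  rcases hx with hx | hx
  · exact Or.inr (hK.mem_closedOut y x hx hxy)
  rcases hy with hy | hy
  · exact Or.inl (hK.mem_closedOut x y hy hyx)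
  by_cases hne : x = y
  · exact Or.inl (hne ▸ mem_closedOut_of_mem (hK.self_mem x))
  · exact absurd (hT x hx y hy hne).1 (by tauto)

theorem closedOut_or_of_farStep (hK : IsLocalKernel E S K) (hST : S ∪ T = Set.univ)
    (hT : IsTournamentOn E T) {x y p q p' : V}
    (hxp : Relation.ReflTransGen (FarStep E S K) x p)
    (hyq : Relation.ReflTransGen (FarStep E S K) y q) (hpp' : FarStep E S K p p')
    (h : y ∈ ClosedOut E (K p) ∨ x ∈ ClosedOut E (K q)) :
    y ∈ ClosedOut E (K p') ∨ x ∈ ClosedOut E (K q) := by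
  by_contra! hcon
  obtain ⟨hy, hx⟩ := hcon
  have hyp : y ∈ ClosedOut E (K p) := h.resolve_right hx
  have hp'x := hK.adj_of_farSteps_of_farStep hxp hpp'
  have hqy := hK.eq_or_adj_of_farSteps hyq
  rcases hK.mem_closedOut_or_mem_closedOut hST hT q p' with hp' | hq
  · obtain ⟨k, hk, hkp'⟩ : ∃ k ∈ K q, k = p' ∨ E k p' := by
      rcases hp' with hp' | ⟨k, hk, hkp'⟩
      · exact ⟨p', hp', Or.inl rfl⟩
      · exact ⟨k, hk, Or.inr hkp'⟩
    by_cases hkS : k ∈ S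
    · exact hx (mem_closedOut_of_adj hk (hp'x k hkS hkp'))
    · obtain rfl : k = q := (hK.eq_or_mem q k hk).resolve_right hkS
      obtain rfl : k = y := hqy.resolve_right fun h' => hkS h'.1
      rcases hkp' with rfl | hkp'
      · exact hkS hpp'.1
      · exact (hpp'.2 k hyp).2 hkp'
  · rcases hqy with rfl | ⟨_, hqy⟩
    · exact hy hq
    · obtain ⟨k, hk, hkq⟩ : ∃ k ∈ K p', k = q ∨ E k q := by
        rcases hq with hq | ⟨k, hk, hkq⟩
        · exact ⟨q, hq, Or.inl rfl⟩
        · exact ⟨k, hk, Or.inr hkq⟩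
      have hkS : k ∈ S := by
        rcases hK.eq_or_mem p' k hk with rfl | h'
        · exact hpp'.1
        · exact h'
      exact hy (mem_closedOut_of_adj hk (hqy k hkS hkq))

theorem closedOut_or_of_farSteps (hK : IsLocalKernel E S K) (hST : S ∪ T = Set.univ)
    (hT : IsTournamentOn E T) {x y p q : V}
    (hxp : Relation.ReflTransGen (FarStep E S K) x p)
    (hyq : Relation.ReflTransGen (FarStep E S K) y q) :
    y ∈ ClosedOut E (K p) ∨ x ∈ ClosedOut E (K q) := by
  induction hxp with
  | refl =>
    induction hyq with
    | refl => exact hK.mem_closedOut_or_mem_closedOut hST hT x y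
    | tail hyq hqq' ih =>
      exact (hK.closedOut_or_of_farStep hST hT hyq Relation.ReflTransGen.refl hqq' ih.symm).symm
  | tail hxp hpp' ih => exact hK.closedOut_or_of_farStep hST hT hxp hyq hpp' ih

theorem exists_farSteps_terminal (hK : IsLocalKernel E S K) (hwf : WellFounded (Induce E S))
    (x : V) : ∃ p, Relation.ReflTransGen (FarStep E S K) x p ∧ ∀ u, ¬ FarStep E S K p u := by
  by_cases hx : ∃ u, FarStep E S K x u
  · obtain ⟨u, hu⟩ := hx
    obtain ⟨p, ⟨hp, hpS⟩, hmin⟩ := hwf.has_min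
      {p | Relation.ReflTransGen (FarStep E S K) x p ∧ p ∈ S}
      ⟨u, Relation.ReflTransGen.single hu, hu.1⟩
    exact ⟨p, hp, fun v hv => hmin v ⟨hp.tail hv, hv.1⟩ ⟨hv.1, hpS, hK.adj_of_farStep hv⟩⟩
  · exact ⟨x, Relation.ReflTransGen.refl, not_exists.1 hx⟩

theorem closedOut_subset_of_isFar (hK : IsLocalKernel E S K) (hST : S ∪ T = Set.univ)
    (hT : IsTournamentOn E T) {p u : V} (hu : u ∈ T) (h : IsFar E (K p) u) :
    ClosedOut E (K p) ⊆ ClosedOut E (K u) := by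
  intro z hz
  obtain ⟨hne, hzu⟩ := h z hz
  have hzST : z ∈ S ∪ T := hST ▸ Set.mem_univ z
  rcases hzST with hzS | hzT
  · exact hK.mem_closedOut u z hzS hzu
  · exact mem_closedOut_of_adj (hK.self_mem u) ((hT z hzT u hu hne).1.resolve_left hzu)

end IsLocalKernel

/-- If `D` relates any two elements in at least one direction, then some element is related to
at least half of the total weight. -/
theorem exists_sum_le_two_mul_sum_filter {V : Type*} [Fintype V] [Nonempty V]
    (D : V → V → Prop) [∀ x y, Decidable (D x y)] (hD : ∀ x y, D x y ∨ D y x) (f : V → ℕ) :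
    ∃ x, ∑ y, f y ≤ 2 * ∑ y with D x y, f y := by
  by_contra! hcon
  simp only [Finset.sum_filter] at hcon
  have hpos : 0 < ∑ y, f y := (Nat.zero_le _).trans_lt (hcon (Classical.arbitrary V))
  obtain ⟨x₀, hx₀, hfx₀⟩ : ∃ x ∈ Finset.univ, 0 < f x := Finset.sum_pos_iff.1 hpos
  have hlt : ∑ x, f x * (2 * ∑ y, if D x y then f y else 0) < ∑ x, f x * ∑ y, f y :=
    Finset.sum_lt_sum (fun x _ => Nat.mul_le_mul_left _ (hcon x).le)
      ⟨x₀, hx₀, Nat.mul_lt_mul_of_pos_left (hcon x₀) hfx₀⟩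
  have hsplit : ∑ x, f x * (2 * ∑ y, if D x y then f y else 0) =
      ∑ x, ∑ y, ((if D x y then f x * f y else 0) + if D y x then f x * f y else 0) := by
    have hcomm : ∑ x, ∑ y, (if D y x then f x * f y else 0) =
        ∑ x, ∑ y, if D x y then f x * f y else 0 := by
      rw [Finset.sum_comm]
      simp only [mul_comm]
    simp only [Finset.sum_add_distrib]
    rw [hcomm, ← two_mul, Finset.mul_sum]
    refine Finset.sum_congr rfl fun x _ => ?_
    rw [mul_left_comm, Finset.mul_sum]
    simp only [mul_ite, mul_zero]
  rw [hsplit] at hlt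
  refine hlt.not_ge (Finset.sum_le_sum fun x _ => ?_)
  rw [Finset.mul_sum]
  refine Finset.sum_le_sum fun y _ => ?_
  rcases hD x y with h | h <;> simp [h]

/-- In every oriented graph admitting a break, for every weight function $f$,
there is a 2-kernel $K$ with $2 f(N^+[K]) \ge f(V(G))$. -/
theorem stmt_4 {V : Type*} [Fintype V] (E : V → V → Prop)
    (hor : Oriented E) (hbreak : ∃ S T : Set V, IsBreak E S T) (f : V → ℕ) :
    ∃ K : Set V, IsKernel E 2 K ∧
      (∑ᶠ v : V, f v) ≤ 2 * ∑ᶠ v ∈ ClosedOut E K, f v := by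
  classical
  rcases isEmpty_or_nonempty V with hV | hV
  · exact ⟨∅, ⟨fun x => isEmptyElim x, fun x => isEmptyElim x⟩,
      by rw [finsum_of_isEmpty]; exact Nat.zero_le _⟩
  obtain ⟨S, T, hST, -, hS, hT⟩ := hbreak
  have hwf := hS.wellFounded
  obtain ⟨K, hK⟩ := exists_isLocalKernel hor.1 hwf
  have hsum : ∀ X : Set V, ∑ᶠ v ∈ X, f v = ∑ v with v ∈ X, f v := fun X => by
    rw [finsum_mem_eq_finite_toFinset_sum f (Set.toFinite X)]
    congr 1
    ext v
    simp
  simp only [hsum, finsum_eq_sum_of_fintype]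
  choose g hg hgt using hK.exists_farSteps_terminal hwf
  obtain ⟨x, hx⟩ := exists_sum_le_two_mul_sum_filter (fun x y => y ∈ ClosedOut E (K (g x)))
    (fun x y => hK.closedOut_or_of_farSteps hST hT (hg x) (hg y)) f
  obtain ⟨p, ⟨hp, hpf⟩, hmax⟩ := Set.exists_max_image
    {p | (∀ u, ¬ FarStep E S K p u) ∧ ∑ y, f y ≤ 2 * ∑ y with y ∈ ClosedOut E (K p), f y}
    (fun p => (ClosedOut E (K p)).ncard) (Set.toFinite _) ⟨g x, hgt x, hx⟩
  refine ⟨K p, ⟨hK.stable p, fun u _ => exists_reachesIn_two_of_not_isFar fun hfar => ?_⟩, hpf⟩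
  have huST : u ∈ S ∪ T := hST ▸ Set.mem_univ u
  rcases huST with hu | hu
  · exact hp u ⟨hu, hfar⟩
  have hsub := hK.closedOut_subset_of_isFar hST hT hu hfar
  have huK : u ∈ ClosedOut E (K u) := mem_closedOut_of_mem (hK.self_mem u)
  refine (hmax u ⟨fun v hv => hp v ⟨hv.1, hv.2.anti hsub⟩, hpf.trans ?_⟩).not_gt
    (Set.ncard_lt_ncard ⟨hsub, fun h => (hfar u (h huK)).1 rfl⟩ (Set.toFinite _))
  refine Nat.mul_le_mul_left 2 (Finset.sum_le_sum_of_subset fun v hv => ?_)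
  simp only [Finset.mem_filter, Finset.mem_univ, true_and] at hv ⊢
  exact hsub hv
end

section
/- Let (S,T) be a break of an oriented graph G, and let f : V(G) → ℕ be any map. Then there is a 2-kernel K of G with 2·f(N⁺_G[K]) ≥ f(V(G)) such that either K ⊆ S, or K consists of some vertex v ∈ T together with the unique 1-kernel of the non-neighbourhood of v (the subdigraph induced on the vertices distinct from v and adjacent neither to nor from v). -/
/-- A `k`-kernel of the subdigraph induced on `W`. -/
def IsKernelOn {V : Type*} (E : V → V → Prop) (k : ℕ) (W X : Set V) : Prop :=
  X ⊆ W ∧ StableSet (Induce E W) X ∧ KCovers (Induce E W) k X W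

/-- A finite digraph whose relation is well-founded on `S` has a 1-kernel on each subset of `S`. -/
theorem exists_isKernelOn_one_of_acyclic {V : Type*} [Finite V] {E : V → V → Prop} {S : Set V}
    (hac : AcyclicRel (Induce E S)) (W : Set V) (hW : W ⊆ S) :
    ∃ A ⊆ W, StableSet E A ∧ ∀ w ∈ W, w ∈ A ∨ ∃ a ∈ A, E a w := by
  have hirr : Std.Irrefl (Relation.TransGen (Induce E S)) := by
    refine ⟨fun x hx => ?_⟩
    obtain ⟨y, hxy, hyx⟩ := Relation.TransGen.head'_iff.mp hx
    exact hac x y hxy hyx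
  have hwf : WellFounded (Relation.TransGen (Induce E S)) :=
    Finite.wellFounded_of_trans_of_irrefl _
  induction W using WellFoundedLT.induction with
  | ind W ih =>
  rcases W.eq_empty_or_nonempty with rfl | hne
  · exact ⟨∅, le_rfl, fun x hx => hx.elim, fun w hw => hw.elim⟩
  obtain ⟨s, hs, hmin⟩ := hwf.has_min W hne
  have hsrc : ∀ w ∈ W, ¬ E w s := fun w hw hE =>
    hmin w hw (.single ⟨hW hw, hW hs, hE⟩)
  have hsub : W \ ({s} ∪ {w | E s w}) ⊆ W := Set.sdiff_subset
  obtain ⟨A, hAW, hst, hcov⟩ := ih (W \ ({s} ∪ {w | E s w}))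
    (hsub.ssubset_of_mem_notMem hs (by simp)) (hsub.trans hW)
  refine ⟨insert s A, Set.insert_subset hs (hAW.trans hsub), ?_, ?_⟩
  · rintro x (rfl | hx) y (rfl | hy)
    · exact hsrc _ hs
    · exact fun h => (hAW hy).2 (Or.inr h)
    · exact hsrc x (hAW hx).1
    · exact hst x hx y hy
  · intro w hw
    by_cases hws : w = s
    · exact Or.inl (Or.inl hws)
    by_cases hsw : E s w
    · exact Or.inr ⟨s, Or.inl rfl, hsw⟩
    rcases hcov w ⟨hw, by simp [hws, hsw]⟩ with h | ⟨a, ha, h⟩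
    · exact Or.inl (Or.inr h)
    · exact Or.inr ⟨a, Or.inr ha, h⟩

/-- If any two elements are comparable under `C`, then some element is `C`-related to at least half
of the total weight. -/
theorem exists_half_weight_of_total_s6 {V : Type*} [Fintype V] [Nonempty V] (C : V → V → Prop)
    [DecidableRel C] (htot : ∀ x y, C x y ∨ C y x) (f : V → ℕ) :
    ∃ x, ∑ v, f v ≤ 2 * ∑ v with C x v, f v := by
  by_contra! hlt
  have hF : 0 < ∑ v, f v := (Nat.zero_le _).trans_lt (hlt (Classical.arbitrary V))
  obtain ⟨x₀, -, hx₀⟩ := Finset.exists_ne_zero_of_sum_ne_zero hF.ne'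
  have hsum : ∑ x, f x * (2 * ∑ v with C x v, f v) < ∑ x, f x * ∑ v, f v :=
    Finset.sum_lt_sum (fun x _ => Nat.mul_le_mul_left _ (hlt x).le)
      ⟨x₀, Finset.mem_univ _, Nat.mul_lt_mul_of_pos_left (hlt x₀) (Nat.pos_of_ne_zero hx₀)⟩
  have hexp : ∑ x, f x * (2 * ∑ v with C x v, f v) =
      ∑ x, ∑ y, ((if C x y then f x * f y else 0) + if C y x then f y * f x else 0) := by
    simp_rw [Finset.sum_add_distrib]
    rw [Finset.sum_comm (f := fun x y => if C y x then f y * f x else 0), ← two_mul,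
      Finset.mul_sum]
    refine Finset.sum_congr rfl fun x _ => ?_
    rw [mul_left_comm, Finset.sum_filter, Finset.mul_sum]
    simp only [mul_ite, mul_zero]
  rw [hexp] at hsum
  refine hsum.not_ge (Finset.sum_le_sum fun x _ => ?_)
  rw [Finset.mul_sum]
  refine Finset.sum_le_sum fun y _ => ?_
  rcases htot x y with h | h
  · simp [h]
  · simp [h, mul_comm (f y)]

/-- A total relation has an element satisfying `P` that is related to at least half of the total
weight, provided each `x` failing `P` is unrelated to some `y` such that everything related to `y`
is also related to `x`. -/
theorem exists_half_weight_of_dominated {V : Type*} [Fintype V] [Nonempty V] (C : V → V → Prop)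
    [DecidableRel C] (htot : ∀ x y, C x y ∨ C y x) (P : V → Prop)
    (hdom : ∀ x, ¬ P x → ∃ y, ¬ C x y ∧ ∀ w, C w y → C w x) (f : V → ℕ) :
    ∃ x, P x ∧ ∑ v, f v ≤ 2 * ∑ v with C x v, f v := by
  have hφ : ∀ x, ∃ y, P y ∧ ∀ w, C w y → C w x := by
    intro x
    induction x using (measure fun x => Fintype.card {w // C w x}).wf.induction with
    | h x ih =>
    by_cases hx : P x
    · exact ⟨x, hx, fun _ => id⟩
    obtain ⟨y, hxy, hy⟩ := hdom x hx
    have hlt : Fintype.card {w // C w y} < Fintype.card {w // C w x} := by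
      rw [Fintype.card_subtype, Fintype.card_subtype]
      refine Finset.card_lt_card (Finset.ssubset_iff_subset_ne.mpr ⟨fun w => ?_, fun heq => ?_⟩)
      · simpa using hy w
      · have : x ∈ Finset.univ.filter (C · y) := heq ▸ by simpa using htot x x
        exact hxy (by simpa using this)
    obtain ⟨z, hz, hzy⟩ := ih y hlt
    exact ⟨z, hz, fun w hw => hy w (hzy w hw)⟩
  choose φ hP hφ using hφ
  obtain ⟨x, hx⟩ := exists_half_weight_of_total_s6 (fun x y => C (φ x) y)
    (fun x y => (htot (φ x) (φ y)).imp (hφ y _) (hφ x _)) f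
  exact ⟨φ x, hP x, hx⟩

theorem reachesIn_two_of_mem_closedOut {V : Type*} {E : V → V → Prop} {X : Set V} {z y : V}
    (hz : z ∈ ClosedOut E X) (hzy : z = y ∨ E z y) : ∃ x ∈ X, ReachesIn E 2 x y := by
  rcases hz with hz | ⟨x, hx, hxz⟩
  · refine ⟨z, hz, ?_⟩
    rcases hzy with rfl | h
    · exact Or.inl rfl
    · exact Or.inr ⟨y, h, Or.inl rfl⟩
  · refine ⟨x, hx, Or.inr ⟨z, hxz, ?_⟩⟩
    rcases hzy with rfl | h
    · exact Or.inl rfl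
    · exact Or.inr ⟨y, h, rfl⟩

/-- If $(S,T)$ is a break of an oriented graph $G$ and $f$ a weight function, there
is a 2-kernel $K$ with $2f(N^+[K]) \ge f(V(G))$, where either $K ⊆ S$, or $K$ consists
of a vertex $v ∈ T$ together with the (unique) 1-kernel of its non-neighbourhood. -/
theorem stmt_6 {V : Type*} [Fintype V] (E : V → V → Prop)
    (hor : Oriented E) (S T : Set V) (hbreak : IsBreak E S T) (f : V → ℕ) :
    ∃ K : Set V, IsKernel E 2 K ∧
      (∑ᶠ v : V, f v) ≤ 2 * (∑ᶠ v ∈ ClosedOut E K, f v) ∧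
      (K ⊆ S ∨ ∃ v ∈ T, ∃ A : Set V,
        IsKernelOn E 1 {u | u ≠ v ∧ ¬ E u v ∧ ¬ E v u} A ∧ K = insert v A) := by
  classical
  obtain ⟨hcover, -, hac, htour⟩ := hbreak
  have hST : ∀ v, v ∈ S ∨ v ∈ T := fun v => by
    have : v ∈ S ∪ T := hcover ▸ Set.mem_univ v
    exact this
  rcases isEmpty_or_nonempty V with hV | hV
  · exact ⟨∅, ⟨fun x => hV.elim x, fun x => hV.elim x⟩, by simp [finsum_of_isEmpty], Or.inl (Set.empty_subset S)⟩
  choose A hAsub hAst hAcov using fun x => exists_isKernelOn_one_of_acyclic hac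
    {u | u ∈ S ∧ u ≠ x ∧ ¬ E u x ∧ ¬ E x u} (fun _ hu => hu.1)
  let Z : V → Set V := fun x => insert x (A x)
  have hnon : ∀ x y, y ∈ S → ¬ E y x → y ∈ ClosedOut E (Z x) := by
    intro x y hy hyx
    by_cases hne : y = x
    · exact Or.inl (Or.inl hne)
    by_cases hxy : E x y
    · exact Or.inr ⟨x, Or.inl rfl, hxy⟩
    rcases hAcov x y ⟨hy, hne, hyx, hxy⟩ with h | ⟨a, ha, h⟩
    · exact Or.inl (Or.inr h)
    · exact Or.inr ⟨a, Or.inr ha, h⟩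
  have htot : ∀ x y, y ∈ ClosedOut E (Z x) ∨ x ∈ ClosedOut E (Z y) := by
    intro x y
    by_cases hne : y = x
    · exact Or.inl (Or.inl (Or.inl hne))
    by_cases hxy : E x y
    · exact Or.inl (Or.inr ⟨x, Or.inl rfl, hxy⟩)
    by_cases hyx : E y x
    · exact Or.inr (Or.inr ⟨y, Or.inl rfl, hyx⟩)
    rcases hST y with hy | hy
    · exact Or.inl (hnon x y hy hyx)
    rcases hST x with hx | hx
    · exact Or.inr (hnon y x hx hxy)
    exact absurd (htour y hy x hx hne).1 (by simp [hxy, hyx])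
  have hdom : ∀ x, ¬ KCovers E 2 (Z x) Set.univ → ∃ y, y ∉ ClosedOut E (Z x) ∧
      ∀ w, y ∈ ClosedOut E (Z w) → x ∈ ClosedOut E (Z w) := by
    intro x hx
    simp only [KCovers, not_forall] at hx
    obtain ⟨y, -, hy⟩ := hx
    have hun : ∀ z, z = y ∨ E z y → z ∉ ClosedOut E (Z x) := fun z hzy hz =>
      hy (reachesIn_two_of_mem_closedOut hz hzy)
    refine ⟨y, hun y (Or.inl rfl), fun w hw => ?_⟩
    obtain ⟨z, hzw, hzy⟩ : ∃ z ∈ Z w, z = y ∨ E z y := by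
      rcases hw with hw | ⟨z, hz, hzy⟩
      · exact ⟨y, hw, Or.inl rfl⟩
      · exact ⟨z, hz, Or.inr hzy⟩
    by_cases hzx : E z x
    · exact Or.inr ⟨z, hzw, hzx⟩
    have hzc := hun z hzy
    have hzS : z ∉ S := fun hzS => hzc (hnon x z hzS hzx)
    obtain rfl : z = w := hzw.resolve_right fun h => hzS (hAsub w h).1
    exact (htot x z).resolve_left hzc
  obtain ⟨x, hx, hfx⟩ := exists_half_weight_of_dominated (fun x y => y ∈ ClosedOut E (Z x))
    htot (fun x => KCovers E 2 (Z x) Set.univ) hdom f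
  refine ⟨Z x, ⟨?_, hx⟩, ?_, ?_⟩
  · rintro a (rfl | ha) b (rfl | hb)
    · exact hor.1 _
    · exact (hAsub _ hb).2.2.2
    · exact (hAsub _ ha).2.2.1
    · exact hAst x a ha b hb
  · have hsum : ∑ᶠ v ∈ ClosedOut E (Z x), f v = ∑ v with v ∈ ClosedOut E (Z x), f v := by
      rw [← finsum_mem_coe_finset]
      simp
    rwa [finsum_eq_sum_of_fintype, hsum]
  · rcases hST x with hxS | hxT
    · exact Or.inl (Set.insert_subset hxS fun a ha => (hAsub x ha).1)
    refine Or.inr ⟨x, hxT, A x, ⟨fun a ha => (hAsub x ha).2, ?_, ?_⟩, rfl⟩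
    · exact fun a ha b hb h => hAst x a ha b hb h.2.2
    · intro y hy
      have hyS : y ∈ S := (hST y).resolve_right fun hyT => by
        simpa [hy.2.1, hy.2.2] using (htour y hyT x hxT hy.1).1
      rcases hAcov x y ⟨hyS, hy⟩ with h | ⟨a, ha, h⟩
      · exact ⟨y, h, Or.inl rfl⟩
      · exact ⟨a, ha, Or.inr ⟨y, ⟨(hAsub x ha).2, hy, h⟩, rfl⟩⟩
end

section
/- In every oriented graph G whose vertex set can be partitioned into a tournament and a set inducing an acyclic subdigraph, there is a 2-kernel K such that at least half the vertices of G belong to K or have an in-neighbour in K, i.e. 2·|N⁺_G[K]| ≥ |V(G)|. -/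
/-- Two-step covering, phrased as iterated closed out-neighbourhoods. -/
theorem kCovers_two_of_closedOut {V : Type*} {E : V → V → Prop} {K : Set V}
    (h : ∀ y, y ∈ ClosedOut E (ClosedOut E K)) : KCovers E 2 K Set.univ := by
  intro y _
  rcases h y with (hy | ⟨x, hx, hxy⟩) | ⟨z, hz | ⟨x, hx, hxz⟩, hzy⟩
  · exact ⟨y, hy, Or.inl rfl⟩
  · exact ⟨x, hx, Or.inr ⟨y, hxy, Or.inl rfl⟩⟩
  · exact ⟨z, hz, Or.inr ⟨y, hzy, Or.inl rfl⟩⟩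
  · exact ⟨x, hx, Or.inr ⟨z, hxz, Or.inr ⟨y, hzy, rfl⟩⟩⟩

/-- Every subset of a set on which the digraph is well-founded has a 1-kernel. -/
theorem exists_oneKernel_of_wellFounded {V : Type*} {E : V → V → Prop} {S X : Set V}
    (hwf : WellFounded (Induce E S)) (hX : X ⊆ S) :
    ∃ B ⊆ X, StableSet E B ∧ X ⊆ ClosedOut E B := by
  have hXwf : WellFounded (Induce E X) :=
    Subrelation.wf (fun {a b} (h : Induce E X a b) => ⟨hX h.1, hX h.2.1, h.2.2⟩) hwf
  let P : V → Prop := hXwf.fix fun x ih => x ∈ X ∧ ∀ y (h : Induce E X y x), ¬ ih y h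
  have hP : ∀ x, P x ↔ x ∈ X ∧ ∀ y, Induce E X y x → ¬ P y := fun x => by
    conv_lhs => rw [show P x = _ from hXwf.fix_eq _ x]
  refine ⟨{x | P x}, fun x hx => ((hP x).1 hx).1, ?_, ?_⟩
  · intro x hx y hy hxy
    exact ((hP y).1 hy).2 x ⟨((hP x).1 hx).1, ((hP y).1 hy).1, hxy⟩ hx
  · intro x hx
    by_cases hPx : P x
    · exact Or.inl hPx
    · have := mt (hP x).2 hPx
      push Not at this
      obtain ⟨y, hy, hPy⟩ := this hx
      exact Or.inr ⟨y, hPy, hy.2.2⟩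

open Classical in
/-- If of any two vertices (possibly equal) one lies in the set assigned to the other, then some
vertex is assigned a set of at least half the total weight. -/
theorem exists_half_weight {V : Type*} [Fintype V] [Nonempty V] (w : V → ℕ) (C : V → Set V)
    (hC : ∀ x y, y ∈ C x ∨ x ∈ C y) :
    ∃ x, ∑ y, w y ≤ 2 * ∑ y, if y ∈ C x then w y else 0 := by
  by_contra! hcon
  set W := ∑ y, w y with hW
  have hpair : W * W ≤ ∑ x, w x * (2 * ∑ y, if y ∈ C x then w y else 0) := by
    calc W * W = ∑ x, ∑ y, w x * w y := Finset.sum_mul_sum ..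
      _ ≤ ∑ x, ∑ y, ((if y ∈ C x then w x * w y else 0) +
            if x ∈ C y then w x * w y else 0) := by
          refine Finset.sum_le_sum fun x _ => Finset.sum_le_sum fun y _ => ?_
          rcases hC x y with h | h <;> simp [h]
      _ = (∑ x, ∑ y, if y ∈ C x then w x * w y else 0) +
            ∑ y, ∑ x, if x ∈ C y then w x * w y else 0 := by
          simp only [Finset.sum_add_distrib]
          rw [Finset.sum_comm (f := fun x y => if x ∈ C y then w x * w y else 0)]
      _ = ∑ x, w x * (2 * ∑ y, if y ∈ C x then w y else 0) := by
          rw [← Finset.sum_add_distrib]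
          refine Finset.sum_congr rfl fun x _ => ?_
          rw [two_mul, mul_add, Finset.mul_sum]
          simp only [mul_comm (w x), ite_mul, zero_mul]
  obtain ⟨x₀⟩ := ‹Nonempty V›
  have hpos : 0 < W := lt_of_le_of_lt (Nat.zero_le _) (hcon x₀)
  have hle : ∑ x, w x * (2 * ∑ y, if y ∈ C x then w y else 0) ≤ ∑ x, w x * (W - 1) :=
    Finset.sum_le_sum fun x _ => Nat.mul_le_mul_left _ (Nat.le_sub_one_of_lt (hcon x))
  rw [← Finset.sum_mul, ← hW] at hle
  have := Nat.le_of_mul_le_mul_left (hpair.trans hle) hpos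
  omega

/-- When no edge `p → v` satisfies `N⁻(p) ⊆ N⁻(v)`, every vertex `v` of the tournament lies in a
2-kernel whose closed out-neighbourhood contains all vertices but the in-neighbours of `v`. -/
theorem exists_twoKernel_of_notMem {V : Type*} {E : V → V → Prop} {S : Set V}
    (hT : ∀ u v, u ∉ S → v ∉ S → u ≠ v → E u v ∨ E v u) (hor : Oriented E)
    (hwf : WellFounded (Induce E S)) (hred : ∀ p v, E p v → ∃ q, E q p ∧ ¬ E q v)
    {v : V} (hv : v ∉ S) :
    ∃ K : Set V, StableSet E K ∧ (∀ y, y ∈ ClosedOut E (ClosedOut E K)) ∧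
      (∀ y, ¬ E y v → y ∈ ClosedOut E K) ∧ ∀ k ∈ K, k ∉ S → k = v := by
  obtain ⟨B, hBX, hB, hXB⟩ := exists_oneKernel_of_wellFounded (E := E)
    (X := {x | x ∈ S ∧ ¬ E v x ∧ ¬ E x v}) hwf (fun x hx => hx.1)
  have hcov : ∀ y, ¬ E y v → y ∈ ClosedOut E (insert v B) := by
    intro y hy
    by_cases hvy : E v y
    · exact Or.inr ⟨v, Set.mem_insert _ _, hvy⟩
    by_cases hyS : y ∈ S
    · rcases hXB ⟨hyS, hvy, hy⟩ with h | ⟨b, hb, hby⟩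
      · exact Or.inl (Or.inr h)
      · exact Or.inr ⟨b, Or.inr hb, hby⟩
    · by_cases hyv : y = v
      · exact Or.inl (Or.inl hyv)
      · exact ((hT y v hyS hv hyv).elim hy hvy).elim
  refine ⟨insert v B, ?_, ?_, hcov, ?_⟩
  · rintro x (rfl | hx) y (rfl | hy)
    · exact hor.1 _
    · exact (hBX hy).2.1
    · exact (hBX hx).2.2
    · exact hB x hx y hy
  · intro y
    by_cases hy : E y v
    · obtain ⟨q, hqy, hqv⟩ := hred y v hy
      exact Or.inr ⟨q, hcov q hqv, hqy⟩
    · exact Or.inl (hcov y hy)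
  · rintro k (rfl | hk) hkS
    · rfl
    · exact absurd (hBX hk).1 hkS

open Classical in
/-- The weighted theorem when no edge `p → v` satisfies `N⁻(p) ⊆ N⁻(v)`. -/
theorem exists_twoKernel_half_weight_of_reduced {V : Type*} [Fintype V] {E : V → V → Prop}
    {S : Set V} (hT : ∀ u v, u ∉ S → v ∉ S → u ≠ v → E u v ∨ E v u) (hor : Oriented E)
    (hwf : WellFounded (Induce E S)) (hred : ∀ p v, E p v → ∃ q, E q p ∧ ¬ E q v)
    (w : V → ℕ) :
    ∃ K : Set V, StableSet E K ∧ (∀ y, y ∈ ClosedOut E (ClosedOut E K)) ∧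
      ∑ y, w y ≤ 2 * ∑ y, if y ∈ ClosedOut E K then w y else 0 := by
  rcases isEmpty_or_nonempty V with hV | hV
  · exact ⟨∅, fun x => hV.elim x, fun x => hV.elim x, by simp⟩
  have hex : ∀ v, ∃ K : Set V, v ∉ S →
      StableSet E K ∧ (∀ y, y ∈ ClosedOut E (ClosedOut E K)) ∧
      (∀ y, ¬ E y v → y ∈ ClosedOut E K) ∧ ∀ k ∈ K, k ∉ S → k = v := fun v => by
    by_cases hv : v ∈ S
    · exact ⟨∅, fun h => absurd hv h⟩
    · obtain ⟨K, hK⟩ := exists_twoKernel_of_notMem hT hor hwf hred hv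
      exact ⟨K, fun _ => hK⟩
  choose K hK using hex
  let C : V → Set V := fun x => {y | (x ∉ S ∧ y ∈ ClosedOut E (K x)) ∨
    (x ∈ S ∧ y ∈ S ∧ ¬ E y x) ∨ (x ∈ S ∧ y ∉ S ∧ x ∉ ClosedOut E (K y))}
  have hpair : ∀ x y, y ∈ C x ∨ x ∈ C y := by
    intro x y
    by_cases hx : x ∈ S <;> by_cases hy : y ∈ S
    · by_cases h : E y x
      · exact Or.inr (Or.inr (Or.inl ⟨hy, hx, hor.2 _ _ h⟩))
      · exact Or.inl (Or.inr (Or.inl ⟨hx, hy, h⟩))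
    · by_cases h : x ∈ ClosedOut E (K y)
      · exact Or.inr (Or.inl ⟨hy, h⟩)
      · exact Or.inl (Or.inr (Or.inr ⟨hx, hy, h⟩))
    · by_cases h : y ∈ ClosedOut E (K x)
      · exact Or.inl (Or.inl ⟨hx, h⟩)
      · exact Or.inr (Or.inr (Or.inr ⟨hy, hx, h⟩))
    · by_cases h : E y x
      · exact Or.inr (Or.inl ⟨hy, (hK y hy).2.2.1 x (hor.2 _ _ h)⟩)
      · exact Or.inl (Or.inl ⟨hx, (hK x hx).2.2.1 y h⟩)
  have hreal : ∀ x, ∃ L : Set V, StableSet E L ∧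
      (∀ y, y ∈ ClosedOut E (ClosedOut E L)) ∧ C x ⊆ ClosedOut E L := by
    intro x
    induction x using hwf.induction with
    | _ x ih =>
      by_cases hx : x ∈ S
      swap
      · refine ⟨K x, (hK x hx).1, (hK x hx).2.1, ?_⟩
        rintro y (h | h | h)
        exacts [h.2, absurd h.1 hx, absurd h.1 hx]
      obtain ⟨B, hBX, hB, hXB⟩ := exists_oneKernel_of_wellFounded (E := E)
        (X := {y | y ∈ S ∧ ¬ E y x}) hwf (fun y hy => hy.1)
      have hxB : x ∈ B := by
        rcases hXB ⟨hx, hor.1 x⟩ with h | ⟨b, hb, hbx⟩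
        · exact h
        · exact absurd hbx (hBX hb).2
      have hedge : ∀ t, t ∉ S → x ∉ ClosedOut E (K t) → E x t := fun t ht h => by
        by_contra hxt
        exact h ((hK t ht).2.2.1 x hxt)
      have hCB : C x ⊆ ClosedOut E B := by
        rintro y (h | h | h)
        · exact absurd hx h.1
        · exact hXB h.2
        · exact Or.inr ⟨x, hxB, hedge y h.2.1 h.2.2⟩
      by_cases hcov : ∀ y, y ∈ ClosedOut E (ClosedOut E B)
      · exact ⟨B, hB, hcov, hCB⟩
      push Not at hcov
      obtain ⟨y, hy⟩ := hcov
      have hyB : y ∉ ClosedOut E B := fun h => hy (Or.inl h)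
      have hin : ∀ z, E z y → z ∉ ClosedOut E B := fun z hzy h => hy (Or.inr ⟨z, h, hzy⟩)
      by_cases hyS : y ∈ S
      swap
      · exact ⟨K y, (hK y hyS).1, (hK y hyS).2.1,
          fun z hz => (hK y hyS).2.2.1 z fun hzy => hin z hzy (hCB hz)⟩
      have hS : ∀ z ∈ S, z ∉ ClosedOut E B → E z x := fun z hz h => by
        by_contra hzx
        exact h (hXB ⟨hz, hzx⟩)
      have hyx : E y x := hS y hyS hyB
      obtain ⟨L, hL, hL2, hCL⟩ := ih y ⟨hyS, hx, hyx⟩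
      refine ⟨L, hL, hL2, fun z hz => hCL ?_⟩
      have hzB := hCB hz
      rcases hz with h | h | h
      · exact absurd hx h.1
      · exact Or.inr (Or.inl ⟨hyS, h.2.1, fun hzy => hin z hzy hzB⟩)
      · refine Or.inr (Or.inr ⟨hyS, h.2.1, ?_⟩)
        rintro (hyK | ⟨k, hk, hky⟩)
        · exact h.2.2 (Or.inr ⟨y, hyK, hyx⟩)
        · by_cases hkS : k ∈ S
          · exact h.2.2 (Or.inr ⟨k, hk, hS k hkS (hin k hky)⟩)
          · have hkz := (hK z h.2.1).2.2.2 k hk hkS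
            exact hin k hky (hkz ▸ hzB)
  obtain ⟨x, hx⟩ := exists_half_weight w C hpair
  obtain ⟨L, hL, hL2, hCL⟩ := hreal x
  refine ⟨L, hL, hL2, hx.trans (Nat.mul_le_mul_left _ (Finset.sum_le_sum fun y _ => ?_))⟩
  by_cases hy : y ∈ C x
  · simp [hy, hCL hy]
  · simp [hy]

open Classical in
/-- Weighted form of the main theorem, for a digraph that is well-founded on `S` and semicomplete
off `S`. -/
theorem exists_twoKernel_half_weight (n : ℕ) {V : Type*} [Fintype V] (hn : Fintype.card V = n)
    {E : V → V → Prop} {S : Set V} (hT : ∀ u v, u ∉ S → v ∉ S → u ≠ v → E u v ∨ E v u)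
    (hor : Oriented E) (hwf : WellFounded (Induce E S)) (w : V → ℕ) :
    ∃ K : Set V, StableSet E K ∧ (∀ y, y ∈ ClosedOut E (ClosedOut E K)) ∧
      ∑ y, w y ≤ 2 * ∑ y, if y ∈ ClosedOut E K then w y else 0 := by
  induction n generalizing V with
  | zero =>
    have := Fintype.card_eq_zero_iff.1 hn
    exact ⟨∅, fun x => isEmptyElim x, fun x => isEmptyElim x, by simp⟩
  | succ n ih =>
    by_cases hred : ∀ p v, E p v → ∃ q, E q p ∧ ¬ E q v
    · exact exists_twoKernel_half_weight_of_reduced hT hor hwf hred w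
    push Not at hred
    obtain ⟨p, v, hpv, hsub⟩ := hred
    have hne : p ≠ v := fun h => hor.1 v (h ▸ hpv)
    let E' : {x // x ≠ v} → {x // x ≠ v} → Prop := fun a b => E a b
    have hcard : Fintype.card {x // x ≠ v} = n := by
      have := Fintype.card_subtype_compl (fun x => x = v)
      rw [Fintype.card_subtype_eq, hn] at this
      simpa using this
    obtain ⟨K, hK, hK2, hw⟩ := ih hcard (E := E') (S := Subtype.val ⁻¹' S)
      (fun a b ha hb hab => hT a b ha hb (fun h => hab (Subtype.ext h)))
      ⟨fun a => hor.1 a, fun a b => hor.2 a b⟩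
      (InvImage.wf Subtype.val hwf) (fun x => w x + if x = ⟨p, hne⟩ then w v else 0)
    have hcl : ∀ x (X : Set {x // x ≠ v}) (Y : Set V), Subtype.val '' X ⊆ Y →
        x ∈ ClosedOut E' X → x.1 ∈ ClosedOut E Y := by
      rintro x X Y hXY (h | ⟨y, hy, hyx⟩)
      · exact Or.inl (hXY ⟨x, h, rfl⟩)
      · exact Or.inr ⟨y, hXY ⟨y, hy, rfl⟩, hyx⟩
    have hv : ∀ (X : Set {x // x ≠ v}) (Y : Set V), Subtype.val '' X ⊆ Y →
        ⟨p, hne⟩ ∈ ClosedOut E' X → v ∈ ClosedOut E Y := by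
      rintro X Y hXY (h | ⟨y, hy, hyx⟩)
      · exact Or.inr ⟨p, hXY ⟨_, h, rfl⟩, hpv⟩
      · exact Or.inr ⟨y, hXY ⟨y, hy, rfl⟩, hsub y hyx⟩
    have himg : Subtype.val '' ClosedOut E' K ⊆ ClosedOut E (Subtype.val '' K) := by
      rintro _ ⟨x, hx, rfl⟩
      exact hcl x K _ subset_rfl hx
    refine ⟨Subtype.val '' K, ?_, ?_, ?_⟩
    · rintro _ ⟨x, hx, rfl⟩ _ ⟨y, hy, rfl⟩
      exact hK x hx y hy
    · intro y
      by_cases hy : y = v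
      · exact hy ▸ hv _ _ himg (hK2 _)
      · exact hcl ⟨y, hy⟩ _ _ himg (hK2 _)
    · have hsplit : ∀ f : V → ℕ, ∑ y, f y = f v + ∑ x : {x // x ≠ v}, f x :=
        fun f => Fintype.sum_eq_add_sum_subtype_ne f v
      rw [hsplit w, hsplit fun y => if y ∈ ClosedOut E (Subtype.val '' K) then w y else 0]
      have hl : ∑ x : {x // x ≠ v}, (w x + if x = ⟨p, hne⟩ then w v else 0) =
          w v + ∑ x : {x // x ≠ v}, w x := by
        rw [Finset.sum_add_distrib, add_comm]
        simp
      have hr : ∑ x, (if x ∈ ClosedOut E' K then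
            w x + (if x = ⟨p, hne⟩ then w v else 0) else 0) =
          (if ⟨p, hne⟩ ∈ ClosedOut E' K then w v else 0) +
            ∑ x : {x // x ≠ v}, if x ∈ ClosedOut E' K then w x else 0 := by
        have hp : (if ⟨p, hne⟩ ∈ ClosedOut E' K then w v else 0) =
            ∑ x, if x = ⟨p, hne⟩ then (if x ∈ ClosedOut E' K then w v else 0) else 0 := by
          simp
        rw [hp]
        rw [← Finset.sum_add_distrib]
        refine Finset.sum_congr rfl fun x _ => ?_
        split_ifs <;> omega
      rw [hl, hr] at hw
      refine hw.trans (Nat.mul_le_mul_left _ (add_le_add ?_ (Finset.sum_le_sum fun x _ => ?_)))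
      · by_cases h : ⟨p, hne⟩ ∈ ClosedOut E' K
        · simp [h, hv K _ subset_rfl h]
        · simp [h]
      · by_cases h : x ∈ ClosedOut E' K
        · simp [h, himg ⟨x, h, rfl⟩]
        · simp [h]

/-- In every oriented graph whose vertex set partitions into a tournament and a set
inducing an acyclic subdigraph, there is a 2-kernel $K$ with $2|N^+[K]| \ge |G|$. -/
theorem stmt_7 {V : Type*} [Fintype V] (E : V → V → Prop)
    (hor : Oriented E) (S T : Set V)
    (hpart : S ∪ T = Set.univ ∧ Disjoint S T)
    (hacS : AcyclicRel (Induce E S)) (hT : IsTournamentOn E T) :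
    ∃ K : Set V, IsKernel E 2 K ∧
      Fintype.card V ≤ 2 * (ClosedOut E K).ncard := by
  classical
  obtain ⟨K, hK, hK2, hw⟩ := exists_twoKernel_half_weight _ rfl (E := E) (S := S)
    (fun u v hu hv huv => (hT u ((Set.mem_union ..).1 (hpart.1 ▸ Set.mem_univ u) |>.resolve_left hu)
      v ((Set.mem_union ..).1 (hpart.1 ▸ Set.mem_univ v) |>.resolve_left hv) huv).1)
    hor hacS.wellFounded (fun _ => 1)
  refine ⟨K, ⟨hK, kCovers_two_of_closedOut hK2⟩, ?_⟩
  rw [Set.ncard_eq_toFinset_card', ← Set.filter_mem_univ_eq_toFinset, Finset.card_filter]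
  simpa only [Finset.sum_const, Finset.card_univ, smul_eq_mul, mul_one] using hw
end

section
/- For every integer k ≥ 2, every digraph G with |V(G)| > 1 that has a spanning arborescence has a k-kernel K with (k−1)·(|K| − 1) ≤ |V(G)| − 2 (equivalently |K| ≤ 1 + (|V(G)|−2)/(k−1)). -/
/-- `A` is a spanning arborescence of the digraph `E`, with root `r`: a spanning
subdigraph in which every vertex is reachable from `r`, the root has in-degree 0,
and every other vertex has in-degree exactly 1 (equivalently, the underlying graph
is a tree all of whose edges are directed away from `r`). -/
def IsSpanningArborescence {V : Type*} (E A : V → V → Prop) (r : V) : Prop :=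
  (∀ u v, A u v → E u v) ∧
  (∀ v, Relation.ReflTransGen A r v) ∧
  (∀ u, ¬ A u r) ∧
  (∀ v, v ≠ r → ∃! u, A u v)

theorem ReachesIn.refl {V : Type*} {E : V → V → Prop} (n : ℕ) (x : V) : ReachesIn E n x x := by
  cases n with
  | zero => rfl
  | succ n => exact Or.inl rfl

theorem ReachesIn.succ {V : Type*} {E : V → V → Prop} {n : ℕ} {x y : V}
    (h : ReachesIn E n x y) : ReachesIn E (n + 1) x y := by
  induction n generalizing x with
  | zero => exact Or.inl h
  | succ n ih =>
    rcases h with h | ⟨z, hz, h⟩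
    · exact Or.inl h
    · exact Or.inr ⟨z, hz, ih h⟩

theorem ReachesIn.mono {V : Type*} {E : V → V → Prop} {m n : ℕ} (hmn : m ≤ n) {x y : V}
    (h : ReachesIn E m x y) : ReachesIn E n x y := by
  induction hmn with
  | refl => exact h
  | step _ ih => exact ih.succ

theorem ReachesIn.trans {V : Type*} {E : V → V → Prop} {m n : ℕ} {x y z : V}
    (hxy : ReachesIn E m x y) (hyz : ReachesIn E n y z) : ReachesIn E (m + n) x z := by
  induction m generalizing x with
  | zero =>
    obtain rfl : x = y := hxy
    exact hyz.mono (by omega)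
  | succ m ih =>
    rcases hxy with rfl | ⟨w, hw, h⟩
    · exact hyz.mono (by omega)
    · have : ReachesIn E (m + n + 1) x z := Or.inr ⟨w, hw, ih h⟩
      exact this.mono (by omega)

theorem ReachesIn.of_adj {V : Type*} {E : V → V → Prop} {x y : V} (h : E x y) :
    ReachesIn E 1 x y :=
  Or.inr ⟨y, h, rfl⟩

theorem ReachesIn.exists_adj_right {V : Type*} {E : V → V → Prop} {n : ℕ} {x y : V}
    (h : ReachesIn E (n + 1) x y) (hxy : y ≠ x) : ∃ u, ReachesIn E n x u ∧ E u y := by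
  induction n generalizing x with
  | zero =>
    rcases h with rfl | ⟨z, hz, rfl⟩
    · exact absurd rfl hxy
    · exact ⟨x, rfl, hz⟩
  | succ n ih =>
    rcases h with rfl | ⟨z, hz, h⟩
    · exact absurd rfl hxy
    · by_cases hyz : y = z
      · subst hyz
        exact ⟨x, .refl _ _, hz⟩
      · obtain ⟨u, hu, huy⟩ := ih h hyz
        exact ⟨u, Or.inr ⟨z, hz, hu⟩, huy⟩

/-- Distance from a root that reaches every vertex. -/
theorem exists_level_function {V : Type*} {E : V → V → Prop} {r : V}
    (h : ∀ v, Relation.ReflTransGen E r v) :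
    ∃ d : V → ℕ, ∀ v, v ≠ r → ∃ u, E u v ∧ d u + 1 = d v := by
  classical
  have hex : ∀ v, ∃ n, ReachesIn E n r v := fun v => by
    induction h v with
    | refl => exact ⟨0, rfl⟩
    | tail _ huv ih =>
      obtain ⟨n, hn⟩ := ih
      exact ⟨n + 1, hn.trans (.of_adj huv)⟩
  refine ⟨fun v => Nat.find (hex v), fun v hv => ?_⟩
  have hspec := Nat.find_spec (hex v)
  obtain ⟨n, hn⟩ : ∃ n, Nat.find (hex v) = n + 1 := by
    refine Nat.exists_eq_succ_of_ne_zero fun h0 => hv ?_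
    rw [h0] at hspec
    exact Eq.symm hspec
  rw [hn] at hspec
  obtain ⟨u, hu, huv⟩ := hspec.exists_adj_right hv
  refine ⟨u, huv, le_antisymm ?_ ?_⟩ <;> dsimp only
  · rw [hn]
    exact Nat.succ_le_succ (Nat.find_min' (hex u) hu)
  · exact Nat.find_min' (hex v) ((Nat.find_spec (hex u)).trans (.of_adj huv))

/-- The Chvátal–Lovász theorem: every vertex set of a finite digraph is 2-covered by
one of its stable subsets. -/
theorem exists_stableSet_kCovers_two {V : Type*} {E : V → V → Prop} (hirr : ∀ v, ¬ E v v)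
    (W : Finset V) : ∃ K ⊆ W, StableSet E (K : Set V) ∧ KCovers E 2 (K : Set V) (W : Set V) := by
  classical
  induction W using Finset.strongInduction with
  | H W ih =>
    rcases W.eq_empty_or_nonempty with rfl | ⟨v, hv⟩
    · exact ⟨∅, subset_rfl, by simp [StableSet], by simp [KCovers]⟩
    have hss : W.filter (fun w => w ≠ v ∧ ¬ E v w) ⊂ W := by
      rw [Finset.filter_ssubset]
      exact ⟨v, hv, by simp⟩
    obtain ⟨K, hKW, hK, hcov⟩ := ih _ hss
    by_cases hKv : ∃ x ∈ K, E x v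
    · obtain ⟨x, hx, hxv⟩ := hKv
      refine ⟨K, hKW.trans hss.subset, hK, fun w hw => ?_⟩
      by_cases h : w ≠ v ∧ ¬ E v w
      · exact hcov w (by simpa using ⟨hw, h⟩)
      · refine ⟨x, hx, ?_⟩
        by_cases hwv : w = v
        · exact hwv ▸ (ReachesIn.of_adj hxv).succ
        · exact (ReachesIn.of_adj hxv).trans (.of_adj (by tauto))
    · refine ⟨insert v K, Finset.insert_subset hv (hKW.trans hss.subset), ?_, fun w hw => ?_⟩
      · have hvK : ∀ y ∈ K, ¬ E v y := fun y hy => (Finset.mem_filter.1 (hKW hy)).2.2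
        intro x hx y hy hxy
        rcases Finset.mem_insert.1 hx with rfl | hxK <;>
          rcases Finset.mem_insert.1 hy with rfl | hyK
        · exact hirr _ hxy
        · exact hvK y hyK hxy
        · exact hKv ⟨x, hxK, hxy⟩
        · exact hK x hxK y hyK hxy
      · by_cases h : w ≠ v ∧ ¬ E v w
        · obtain ⟨x, hx, hxw⟩ := hcov w (by simpa using ⟨hw, h⟩)
          exact ⟨x, Finset.mem_insert_of_mem hx, hxw⟩
        · refine ⟨v, Finset.mem_insert_self v K, ?_⟩
          by_cases hwv : w = v
          · exact hwv ▸ .refl _ _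
          · exact (ReachesIn.of_adj (by tauto)).succ

theorem exists_reachesIn_level {V : Type*} {E : V → V → Prop} {r : V} {d : V → ℕ}
    (hd : ∀ v, v ≠ r → ∃ u, E u v ∧ d u + 1 = d v) (j : ℕ) (v : V) :
    ∃ x, ReachesIn E j x v ∧ (x = r ∨ d x + j = d v) := by
  induction j with
  | zero => exact ⟨v, rfl, Or.inr rfl⟩
  | succ j ih =>
    obtain ⟨x, hx, h⟩ := ih
    by_cases hxr : x = r
    · exact ⟨x, hx.succ, Or.inl hxr⟩
    · obtain ⟨u, hux, hdu⟩ := hd x hxr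
      refine ⟨u, Or.inr ⟨x, hux, hx⟩, Or.inr ?_⟩
      have := h.resolve_left hxr
      omega

/-- Levels in one residue class modulo `m`, together with the root, `(m - 1)`-cover all vertices. -/
theorem exists_reachesIn_level_mod {V : Type*} {E : V → V → Prop} {r : V} {d : V → ℕ}
    (hd : ∀ v, v ≠ r → ∃ u, E u v ∧ d u + 1 = d v) {m i : ℕ} (hi : i < m) (v : V) :
    ∃ x, ReachesIn E (m - 1) x v ∧ (x = r ∨ d x % m = i) := by
  obtain ⟨x, hx, h⟩ := exists_reachesIn_level hd ((d v + (m - i)) % m) v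
  have hlt : (d v + (m - i)) % m < m := Nat.mod_lt _ (by omega)
  refine ⟨x, hx.mono (by omega), h.imp_right fun h => ?_⟩
  have hdiv := Nat.div_add_mod (d v + (m - i)) m
  have hadd : d x + m = i + m * ((d v + (m - i)) / m) := by omega
  rw [← Nat.add_mod_right, hadd, Nat.add_mul_mod_self_left, Nat.mod_eq_of_lt hi]

/-- For $k \ge 2$: every digraph with more than one vertex having a spanning
arborescence has a $k$-kernel $K$ with $(k-1)(|K|-1) \le |G|-2$. -/
theorem stmt_10 {V : Type*} [Fintype V] (E : V → V → Prop) (k : ℕ) (hk : 2 ≤ k)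
    (hirr : ∀ v, ¬ E v v) (hcard : 1 < Fintype.card V)
    (harb : ∃ (A : V → V → Prop) (r : V), IsSpanningArborescence E A r) :
    ∃ K : Finset V, IsKernel E k (↑K : Set V) ∧
      ((k : ℤ) - 1) * ((K.card : ℤ) - 1) ≤ (Fintype.card V : ℤ) - 2 := by
  classical
  obtain ⟨A, r, hAE, hreach, -, -⟩ := harb
  obtain ⟨d, hd⟩ := exists_level_function fun v => Relation.ReflTransGen.mono hAE _ _ (hreach v)
  have : Nontrivial V := Fintype.one_lt_card_iff_nontrivial.1 hcard
  obtain ⟨c, hrc⟩ : ∃ c, E r c := by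
    obtain ⟨w, hw⟩ := exists_ne r
    rcases (hreach w).cases_head with h | ⟨c, hc, -⟩
    · exact absurd h.symm hw
    · exact ⟨c, hAE _ _ hc⟩
  have hcr : c ≠ r := fun h => hirr r (h ▸ hrc)
  obtain ⟨m, rfl⟩ : ∃ m, k = m + 1 := ⟨k - 1, by omega⟩
  let S : Finset V := Finset.univ \ {r, c}
  have hS : S.card + 2 = Fintype.card V := by
    rw [← Finset.card_pair hcr.symm, Finset.card_sdiff_add_card_eq_card (Finset.subset_univ _),
      Finset.card_univ]
  obtain ⟨i, hi, hcardi⟩ : ∃ i ∈ Finset.range m, m * (S.filter (d · % m = i)).card ≤ S.card := by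
    refine Finset.exists_le_of_sum_le ⟨0, by simp; omega⟩ ?_
    rw [← Finset.mul_sum, ← Finset.card_eq_sum_card_fiberwise]
    · simp
    · intro v _
      simpa using Nat.mod_lt _ (by omega)
  obtain ⟨K, hKW, hK, hcov⟩ := exists_stableSet_kCovers_two hirr
    (Finset.univ.filter fun v => v = r ∨ d v % m = i)
  refine ⟨K, ⟨hK, fun v _ => ?_⟩, ?_⟩
  · obtain ⟨x, hxv, hx⟩ := exists_reachesIn_level_mod hd (Finset.mem_range.1 hi) v
    obtain ⟨y, hy, hyx⟩ := hcov x (by simpa using hx)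
    exact ⟨y, hy, (hyx.trans hxv).mono (by omega)⟩
  · have hsub : K ⊆ insert (if r ∈ K then r else c) (S.filter (d · % m = i)) := by
      intro v hv
      have hvW := (Finset.mem_filter.1 (hKW hv)).2
      have hrK : v = c → r ∉ K := fun h hr => hK r hr v hv (h ▸ hrc)
      simp only [S, Finset.mem_insert, Finset.mem_filter, Finset.mem_sdiff, Finset.mem_univ,
        Finset.mem_singleton]
      split_ifs with h <;> grind
    have hKc := (Finset.card_le_card hsub).trans (Finset.card_insert_le _ _)
    have hmul : m * K.card ≤ S.card + m :=
      (Nat.mul_le_mul_left m hKc).trans (by rw [Nat.mul_succ]; omega)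
    zify at hmul hS
    push_cast
    linarith
end
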